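/- For every n ≤ 5 and every k with 2 ≤ k ≤ n, the maximum, over all PFAs with n states and all subsets S of size k of the state set such that some word carefully synchronizes S, of the length of a shortest word carefully synchronizing S, equals T(n,k), where T(3,2)=3, T(3,3)=4, T(4,2)=6, T(4,3)=10, T(4,4)=10, T(5,2)=10, T(5,3)=20, T(5,4)=22, T(5,5)=21. Moreover, if a PFA with n ≤ 5 states has some subset of size strictly less than k which is not carefully synchronized by any word, and a subset S of size k is carefully synchronized by some word, then the shortest word carefully synchronizing S has length strictly less than T(n,k). -/

import Mathlib

/-- Action of a PFA (partial) transition function on a subset of states along a word: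
one step maps `S` to `{δ q a : q ∈ S}` if `δ q a` is defined for all `q ∈ S`,
and to `∅` otherwise. -/
def pfaRun {n m : ℕ} (δ : Fin n → Fin m → Option (Fin n)) :
    Finset (Fin n) → List (Fin m) → Finset (Fin n)
  | S, [] => S
  | S, a :: w =>
      pfaRun δ
        (if ∀ q ∈ S, (δ q a).isSome then S.image (fun q => (δ q a).getD q) else ∅) w

/-- A word `w` carefully synchronizes the subset `S` in the PFA `δ`. -/
def pfaSync {n m : ℕ} (δ : Fin n → Fin m → Option (Fin n)) (S : Finset (Fin n))
    (w : List (Fin m)) : Prop :=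
  (pfaRun δ S w).card = 1

/-- `l` is the length of a shortest word carefully synchronizing `S` in the PFA `δ`. -/
def pfaShortestSync {n m : ℕ} (δ : Fin n → Fin m → Option (Fin n)) (S : Finset (Fin n))
    (l : ℕ) : Prop :=
  (∃ w, pfaSync δ S w ∧ w.length = l) ∧ ∀ w, pfaSync δ S w → l ≤ w.length

/-- The table of maximum subset careful synchronization lengths for PFAs with up to 5 states. -/
def T1 : ℕ → ℕ → ℕ
  | 3, 2 => 3
  | 3, 3 => 4
  | 4, 2 => 6
  | 4, 3 => 10
  | 4, 4 => 10
  | 5, 2 => 10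
  | 5, 3 => 20
  | 5, 4 => 22
  | 5, 5 => 21
  | _, _ => 0

section SyncRank

variable {n m : ℕ}

/-- One letter of `pfaRun`. -/
def pfaStep (δ : Fin n → Fin m → Option (Fin n)) (S : Finset (Fin n)) (a : Fin m) :
    Finset (Fin n) :=
  if ∀ q ∈ S, (δ q a).isSome then S.image (fun q => (δ q a).getD q) else ∅

theorem pfaRun_cons (δ : Fin n → Fin m → Option (Fin n)) (S : Finset (Fin n)) (a : Fin m)
    (w : List (Fin m)) : pfaRun δ S (a :: w) = pfaRun δ (pfaStep δ S a) w := rfl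

theorem pfaRun_empty (δ : Fin n → Fin m → Option (Fin n)) (w : List (Fin m)) :
    pfaRun δ ∅ w = ∅ := by
  induction w with
  | nil => rfl
  | cons a w ih => simpa [pfaRun_cons, pfaStep] using ih

/-- Some map sends `X` onto `Y` and lowers `D` by at most one on every nonempty subset of `X`. -/
def IsStep (D : Finset (Fin n) → ℕ) (X Y : Finset (Fin n)) : Prop :=
  ∃ g : Fin n → Fin n, X.image g = Y ∧ ∀ A ⊆ X, A.Nonempty → D A ≤ D (A.image g) + 1

/-- The properties of the length of a shortest synchronizing word, truncated at `B`. -/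
structure IsSyncRank (B : ℕ) (D : Finset (Fin n) → ℕ) : Prop where
  eq_zero_iff : ∀ X : Finset (Fin n), X.Nonempty → (D X = 0 ↔ X.card = 1)
  le_bound : ∀ X, D X ≤ B
  exists_step : ∀ X : Finset (Fin n), 1 < X.card → D X < B → ∃ Y, IsStep D X Y ∧ D Y + 1 = D X

/-- The length of a shortest word synchronizing `X`, truncated at `B`. -/
noncomputable def syncRank (B : ℕ) (δ : Fin n → Fin m → Option (Fin n)) (X : Finset (Fin n)) :
    ℕ :=
  sInf ({l | ∃ w, pfaSync δ X w ∧ w.length = l} ∪ {B})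

theorem syncRank_le_bound (B : ℕ) (δ : Fin n → Fin m → Option (Fin n)) (X : Finset (Fin n)) :
    syncRank B δ X ≤ B :=
  Nat.sInf_le (Or.inr rfl)

theorem syncRank_le_length (B : ℕ) (δ : Fin n → Fin m → Option (Fin n)) {X : Finset (Fin n)}
    {w : List (Fin m)} (h : pfaSync δ X w) : syncRank B δ X ≤ w.length :=
  Nat.sInf_le (Or.inl ⟨w, h, rfl⟩)

theorem exists_word_of_syncRank_lt {B : ℕ} {δ : Fin n → Fin m → Option (Fin n)}
    {X : Finset (Fin n)} (h : syncRank B δ X < B) :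
    ∃ w, pfaSync δ X w ∧ w.length = syncRank B δ X := by
  have hmem := Nat.sInf_mem (s := {l | ∃ w, pfaSync δ X w ∧ w.length = l} ∪ {B}) ⟨B, Or.inr rfl⟩
  rcases hmem with hmem | hmem
  · exact hmem
  · exact absurd (hmem : syncRank B δ X = B) h.ne

theorem syncRank_eq_bound {B : ℕ} {δ : Fin n → Fin m → Option (Fin n)} {X : Finset (Fin n)}
    (h : ¬ ∃ w, pfaSync δ X w) : syncRank B δ X = B := by
  by_contra hne
  obtain ⟨w, hw, -⟩ := exists_word_of_syncRank_lt
    (lt_of_le_of_ne (syncRank_le_bound B δ X) hne)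
  exact h ⟨w, hw⟩

theorem syncRank_eq_of_shortest {B l : ℕ} {δ : Fin n → Fin m → Option (Fin n)}
    {X : Finset (Fin n)} (h : pfaShortestSync δ X l) (hl : l < B) : syncRank B δ X = l := by
  obtain ⟨⟨w, hw, rfl⟩, hmin⟩ := h
  apply le_antisymm (syncRank_le_length B δ hw)
  obtain ⟨w', hw', hlen⟩ := exists_word_of_syncRank_lt ((syncRank_le_length B δ hw).trans_lt hl)
  exact hlen ▸ hmin w' hw'

theorem isSyncRank_syncRank {B : ℕ} (hB : 0 < B) (δ : Fin n → Fin m → Option (Fin n)) :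
    IsSyncRank B (syncRank B δ) where
  eq_zero_iff X _ := by
    constructor
    · intro h
      obtain ⟨w, hw, hlen⟩ := exists_word_of_syncRank_lt (h ▸ hB : syncRank B δ X < B)
      rw [h, List.length_eq_zero_iff] at hlen
      subst hlen
      exact hw
    · intro h
      have : pfaSync δ X [] := h
      simpa using syncRank_le_length B δ this
  le_bound := syncRank_le_bound B δ
  exists_step X hX hlt := by
    obtain ⟨w, hw, hlen⟩ := exists_word_of_syncRank_lt hlt
    cases w with
    | nil => exact absurd hw hX.ne'
    | cons a w =>
      have hdef : ∀ q ∈ X, (δ q a).isSome := by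
        by_contra hdef
        have : pfaRun δ ∅ w = pfaRun δ X (a :: w) := by rw [pfaRun_cons, pfaStep, if_neg hdef]
        rw [pfaSync, ← this, pfaRun_empty] at hw
        simp at hw
      have hstep : ∀ A ⊆ X, pfaStep δ A a = A.image (fun q => (δ q a).getD q) := fun A hA =>
        if_pos fun q hq => hdef q (hA hq)
      have hle : ∀ A ⊆ X, syncRank B δ A ≤
          syncRank B δ (A.image (fun q => (δ q a).getD q)) + 1 := by
        intro A hA
        rcases (syncRank_le_bound B δ (A.image (fun q => (δ q a).getD q))).lt_or_eq with h | h
        · obtain ⟨u, hu, hul⟩ := exists_word_of_syncRank_lt h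
          rw [← hul]
          refine syncRank_le_length (w := a :: u) B δ ?_
          rw [pfaSync, pfaRun_cons, hstep A hA]
          exact hu
        · rw [h]
          exact (syncRank_le_bound B δ A).trans (Nat.le_succ B)
      refine ⟨_, ⟨_, rfl, fun A hA _ => hle A hA⟩, le_antisymm ?_ (hle X subset_rfl)⟩
      rw [← hlen, List.length_cons, Nat.add_le_add_iff_right]
      apply syncRank_le_length
      rwa [pfaSync, ← hstep X subset_rfl]

namespace IsSyncRank

variable {B : ℕ} {D : Finset (Fin n) → ℕ}

theorem nonempty_of_isStep {X Y : Finset (Fin n)} (h : IsStep D X Y) (hX : X.Nonempty) :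
    Y.Nonempty := by
  obtain ⟨g, rfl, -⟩ := h
  exact hX.image g

theorem card_le_of_isStep {X Y : Finset (Fin n)} (h : IsStep D X Y) : Y.card ≤ X.card := by
  obtain ⟨g, rfl, -⟩ := h
  exact Finset.card_image_le

theorem one_lt_card (hD : IsSyncRank B D) {X : Finset (Fin n)} (hX : X.Nonempty)
    (h : 0 < D X) : 1 < X.card := by
  have h1 := hX.card_pos
  have h2 := (hD.eq_zero_iff X hX).not.1 h.ne'
  omega

theorem mono (hD : IsSyncRank B D) {X Y : Finset (Fin n)} (hX : X.Nonempty) (h : X ⊆ Y) :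
    D X ≤ D Y := by
  induction hv : D Y generalizing X Y with
  | zero =>
    have hY := (hD.eq_zero_iff Y (hX.mono h)).1 hv
    have : X = Y := Finset.eq_of_subset_of_card_le h (by rw [hY]; exact hX.card_pos)
    rw [this, hv]
  | succ v ih =>
    rcases (hD.le_bound Y).lt_or_eq with hlt | heq
    · obtain ⟨_, ⟨g, rfl, hg⟩, hgY⟩ := hD.exists_step Y
        (hD.one_lt_card (hX.mono h) (by omega)) hlt
      have := ih (hX.image g) (Finset.image_subset_image h) (by omega)
      have := hg X h hX
      omega
    · rw [← hv, heq]
      exact hD.le_bound X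

theorem exists_level (hD : IsSyncRank B D) {Z : Finset (Fin n)} (hZ : Z.Nonempty)
    (hlt : D Z < B) {u : ℕ} (hu : u ≤ D Z) :
    ∃ X : Finset (Fin n), X.Nonempty ∧ X.card ≤ Z.card ∧ D X = u := by
  induction hv : D Z generalizing Z with
  | zero => exact ⟨Z, hZ, le_rfl, by omega⟩
  | succ v ih =>
    rcases hu.lt_or_eq with hu | rfl
    · obtain ⟨Y, hY, hYZ⟩ := hD.exists_step Z (hD.one_lt_card hZ (by omega)) hlt
      obtain ⟨X, hX, hXY, hXu⟩ := ih (nonempty_of_isStep hY hZ) (by omega) (by omega) (by omega)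
      exact ⟨X, hX, hXY.trans (card_le_of_isStep hY), hXu⟩
    · exact ⟨Z, hZ, le_rfl, rfl⟩

theorem le_add_card (hD : IsSyncRank B D) {Z : Finset (Fin n)} (hZ : Z.Nonempty)
    (hlt : D Z < B) (b : ℕ) (F : Finset (Finset (Fin n)))
    (h : ∀ X : Finset (Fin n), X.Nonempty → X.card ≤ Z.card → D X < B → X ∉ F → D X ≤ b) :
    D Z ≤ b + F.card := by
  have hsub : Finset.Ioc b (D Z) ⊆ F.image D := by
    intro u hu
    rw [Finset.mem_Ioc] at hu
    obtain ⟨X, hX, hXZ, rfl⟩ := hD.exists_level hZ hlt hu.2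
    refine Finset.mem_image_of_mem D (by_contra fun hF => ?_)
    have := h X hX hXZ (hu.2.trans_lt hlt) hF
    omega
  have := (Finset.card_le_card hsub).trans Finset.card_image_le
  rw [Nat.card_Ioc] at this
  omega

/-- The subsets with at least two and at most `k` elements. -/
def midSubsets (n k : ℕ) : Finset (Finset (Fin n)) :=
  Finset.univ.filter fun X => 2 ≤ X.card ∧ X.card ≤ k

theorem eq_zero_of_notMem_midSubsets (hD : IsSyncRank B D) {X : Finset (Fin n)} {k : ℕ}
    (hX : X.Nonempty) (hk : X.card ≤ k) (h : X ∉ midSubsets n k) : D X = 0 := by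
  have := hX.card_pos
  simp only [midSubsets, Finset.mem_filter, Finset.mem_univ, true_and] at h
  exact (hD.eq_zero_iff X hX).2 (by omega)

theorem le_card_midSubsets (hD : IsSyncRank B D) {Z : Finset (Fin n)} (hZ : Z.Nonempty)
    (hlt : D Z < B) {k : ℕ} (hk : Z.card ≤ k) : D Z ≤ (midSubsets n k).card := by
  simpa using hD.le_add_card hZ hlt 0 (midSubsets n k) fun X hX hXZ _ hF =>
    (hD.eq_zero_of_notMem_midSubsets hX (hXZ.trans hk) hF).le

theorem lt_card_midSubsets (hD : IsSyncRank B D) {Z : Finset (Fin n)} (hZ : Z.Nonempty)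
    (hlt : D Z < B) {k : ℕ} (hk : Z.card ≤ k) {X₀ : Finset (Fin n)} (h₀ : X₀.Nonempty)
    (hk₀ : X₀.card ≤ k) (hX₀ : D X₀ = B) : D Z < (midSubsets n k).card := by
  have hmem : X₀ ∈ midSubsets n k := by
    by_contra h
    have := hD.eq_zero_of_notMem_midSubsets h₀ hk₀ h
    omega
  have := hD.le_add_card hZ hlt 0 ((midSubsets n k).erase X₀) fun X hX hXZ hlt' hF => by
    refine (hD.eq_zero_of_notMem_midSubsets hX (hXZ.trans hk) fun hm => hF ?_).le
    exact Finset.mem_erase.2 ⟨fun h => by rw [h] at hlt'; omega, hm⟩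
  have := Finset.card_erase_lt_of_mem hmem
  omega

theorem exists_superset_eq_bound (hD : IsSyncRank B D) {X : Finset (Fin n)} {k : ℕ}
    (hX : X.Nonempty) (h : X.card ≤ k) (hk : k ≤ n) (hXB : D X = B) :
    ∃ Y : Finset (Fin n), Y.card = k ∧ D Y = B := by
  obtain ⟨Y, hXY, -, hY⟩ := Finset.exists_subsuperset_card_eq (Finset.subset_univ X) h
    (by simpa using hk)
  exact ⟨Y, hY, le_antisymm (hD.le_bound Y) (hXB ▸ hD.mono hX hXY)⟩

end IsSyncRank

end SyncRank

section SmallBounds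

variable {n B : ℕ} {D : Finset (Fin n) → ℕ}

theorem card_midSubsets : (IsSyncRank.midSubsets 3 2).card = 3 ∧
    (IsSyncRank.midSubsets 3 3).card = 4 ∧ (IsSyncRank.midSubsets 4 2).card = 6 ∧
    (IsSyncRank.midSubsets 4 3).card = 10 ∧ (IsSyncRank.midSubsets 5 2).card = 10 ∧
    (IsSyncRank.midSubsets 5 3).card = 20 := by
  decide +kernel

theorem card_triples_not_merged_four : ∀ p q : Fin 4, p ≠ q →
    (Finset.univ.filter fun X : Finset (Fin 4) => X.card = 3 ∧ ¬ (p ∈ X ∧ q ∈ X)).card = 2 := by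
  decide +kernel

theorem card_triples_not_merged_five : ∀ p q : Fin 5, p ≠ q →
    (Finset.univ.filter fun X : Finset (Fin 5) => X.card = 3 ∧ ¬ (p ∈ X ∧ q ∈ X)).card = 7 := by
  decide +kernel

theorem card_quadruples_not_merged : ∀ p q : Fin 5, p ≠ q →
    (Finset.univ.filter fun X : Finset (Fin 5) => X.card = 4 ∧ ¬ (p ∈ X ∧ q ∈ X)).card = 2 := by
  decide +kernel

theorem card_triples_not_merged_twice : ∀ R : Finset (Fin 5), R.card = 4 → ∀ p q : Fin 5, p ≠ q →
    ¬ (p ∈ R ∧ q ∈ R) → ∀ p' ∈ R, ∀ q' ∈ R, p' ≠ q' →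
      (Finset.univ.filter fun X : Finset (Fin 5) =>
        X.card = 3 ∧ ¬ (p ∈ X ∧ q ∈ X) ∧ ¬ (X ⊆ R ∧ p' ∈ X ∧ q' ∈ X)).card = 5 := by
  decide +kernel

theorem card_triples_ne : ∀ T : Finset (Fin 5), T.card = 3 → ∀ W : Finset (Fin 5), W.card = 4 →
    ¬ T ⊆ W → ∀ p ∈ W, ∀ q ∈ W, p ≠ q → (Finset.univ.filter fun X : Finset (Fin 5) =>
      X.card = 3 ∧ X ≠ T ∧ ¬ (X ⊆ W ∧ p ∈ X ∧ q ∈ X)).card = 7 := by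
  decide +kernel

theorem card_quadruples_ne : ∀ T : Finset (Fin 5), T.card = 3 → ∀ W : Finset (Fin 5),
    W.card = 4 → ¬ T ⊆ W →
      (Finset.univ.filter fun X : Finset (Fin 5) => X.card = 4 ∧ X ≠ W ∧ ¬ T ⊆ X).card = 2 := by
  decide +kernel

namespace IsSyncRank

theorem card_image_lt {X : Finset (Fin n)} {g : Fin n → Fin n} {p q : Fin n} (hp : p ∈ X)
    (hq : q ∈ X) (hne : p ≠ q) (h : g p = g q) : (X.image g).card < X.card := by
  refine lt_of_le_of_ne Finset.card_image_le fun heq => hne ?_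
  exact Finset.card_image_iff.1 heq hp hq h

/-- If the first letter of a shortest word for `X` does not lead to a set of the same size, then
it merges two states, and so the subsets of `X` containing both have small rank. -/
theorem exists_merge (hD : IsSyncRank B D) {X : Finset (Fin n)} (hX : 1 < X.card)
    (hlt : D X < B) (h : ∀ Y : Finset (Fin n), Y.card = X.card → D Y + 1 ≠ D X) :
    ∃ p ∈ X, ∃ q ∈ X, p ≠ q ∧ ∃ g : Fin n → Fin n, g p = g q ∧
      (∀ A ⊆ X, A.Nonempty → D A ≤ D (A.image g) + 1) ∧ D (X.image g) + 1 = D X := by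
  obtain ⟨_, ⟨g, rfl, hg⟩, hY⟩ := hD.exists_step X hX hlt
  have hinj : ¬ Set.InjOn g X := fun hinj => h _ (Finset.card_image_of_injOn hinj) hY
  simp only [Set.InjOn, not_forall] at hinj
  obtain ⟨p, hp, q, hq, hpq, hne⟩ := hinj
  exact ⟨p, hp, q, hq, hne, g, hpq, hg, hY⟩

theorem le_of_merge (hD : IsSyncRank B D) {X A : Finset (Fin n)} {g : Fin n → Fin n}
    (hg : ∀ A ⊆ X, A.Nonempty → D A ≤ D (A.image g) + 1) (hlt : D (X.image g) < B)
    (hA : A ⊆ X) {p q : Fin n} (hp : p ∈ A) (hq : q ∈ A) (hne : p ≠ q) (h : g p = g q) {k b : ℕ}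
    (hk : A.card ≤ k + 1)
    (hb : ∀ Z : Finset (Fin n), Z.Nonempty → Z.card ≤ k → D Z < B → D Z ≤ b) : D A ≤ b + 1 := by
  have hne' : (A.image g).Nonempty := ⟨_, Finset.mem_image_of_mem g hp⟩
  refine (hg A hA ⟨p, hp⟩).trans (Nat.succ_le_succ (hb _ hne' ?_ ?_))
  · have := card_image_lt hp hq hne h
    omega
  · exact (hD.mono hne' (Finset.image_subset_image hA)).trans_lt hlt

/-- A bound for sets of size at most `k + 1` from a bound for those of size at most `k`. -/
theorem le_add_card_filter (hD : IsSyncRank B D) {Z : Finset (Fin n)} (hZ : Z.Nonempty)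
    (hlt : D Z < B) {k b c : ℕ} (hk : Z.card ≤ k + 1)
    (hb : ∀ X : Finset (Fin n), X.Nonempty → X.card ≤ k → D X < B → D X ≤ b) (hbc : b ≤ c)
    (P : Finset (Fin n) → Prop) [DecidablePred P]
    (hP : ∀ X : Finset (Fin n), X.card = k + 1 → D X < B → ¬ P X → D X ≤ c) :
    D Z ≤ c + (Finset.univ.filter fun X : Finset (Fin n) => X.card = k + 1 ∧ P X).card := by
  refine hD.le_add_card hZ hlt c _ fun X hX hXZ hXB hXF => ?_
  by_cases hXk : X.card = k + 1
  · refine hP X hXk hXB fun hPX => hXF ?_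
    simp [hXk, hPX]
  · exact (hb X hX (by omega) hXB).trans hbc

theorem le_ten_of_four {D : Finset (Fin 4) → ℕ} (hD : IsSyncRank B D)
    (hlt : D Finset.univ < B) : D Finset.univ ≤ 10 := by
  obtain ⟨p, hp, q, hq, hne, g, hpq, hg, hY⟩ := hD.exists_merge (X := Finset.univ) (by decide)
    hlt fun Y hY => by
      rw [(Finset.card_eq_iff_eq_univ Y).1 (by simpa using hY)]
      omega
  have hb : ∀ X : Finset (Fin 4), X.Nonempty → X.card ≤ 2 → D X < B → D X ≤ 6 :=
    fun X hX hk hXB => card_midSubsets.2.2.1 ▸ hD.le_card_midSubsets hX hXB hk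
  have hYB : D (Finset.univ.image g) < B := by omega
  have := hD.le_add_card_filter (k := 2) (b := 6) (c := 7) ⟨_, Finset.mem_image_of_mem g hp⟩ hYB
    (Nat.lt_succ_iff.1 (card_image_lt hp hq hne hpq)) hb (by norm_num)
    (fun X => ¬ (p ∈ X ∧ q ∈ X)) fun X hX _ hXF => by
      rw [not_not] at hXF
      exact hD.le_of_merge hg hYB (Finset.subset_univ X) hXF.1 hXF.2 hne hpq hX.le hb
  rw [card_triples_not_merged_four p q hne] at this
  omega

variable {D : Finset (Fin 5) → ℕ}

theorem le_ten_of_pair (hD : IsSyncRank B D) {X : Finset (Fin 5)} (hX : X.Nonempty)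
    (hk : X.card ≤ 2) (hXB : D X < B) : D X ≤ 10 :=
  card_midSubsets.2.2.2.2.1 ▸ hD.le_card_midSubsets hX hXB hk

theorem le_twenty_of_triple (hD : IsSyncRank B D) {X : Finset (Fin 5)} (hX : X.Nonempty)
    (hk : X.card ≤ 3) (hXB : D X < B) : D X ≤ 20 :=
  card_midSubsets.2.2.2.2.2 ▸ hD.le_card_midSubsets hX hXB hk

theorem le_of_univ (hD : IsSyncRank B D) (hlt : D Finset.univ < B) :
    D Finset.univ ≤ 21 := by
  obtain ⟨p, hp, q, hq, hne, g, hpq, hg, hY⟩ := hD.exists_merge (X := Finset.univ) (by decide)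
    hlt fun Y hY => by
      rw [(Finset.card_eq_iff_eq_univ Y).1 (by simpa using hY)]
      omega
  have hYB : D (Finset.univ.image g) < B := by omega
  have hfin : ∀ X : Finset (Fin 5), X.Nonempty → D X < B := fun X hX =>
    (hD.mono hX (Finset.subset_univ X)).trans_lt hlt
  have h₂ : ∀ X : Finset (Fin 5), X.Nonempty → X.card ≤ 2 → D X < B → D X ≤ 10 :=
    fun X hX hk => hD.le_ten_of_pair hX hk
  have h₃' : ∀ X : Finset (Fin 5), X.card ≤ 3 → p ∈ X → q ∈ X → D X ≤ 11 := fun X hX hpX hqX =>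
    hD.le_of_merge hg hYB (Finset.subset_univ X) hpX hqX hne hpq hX h₂
  have h₃ : ∀ X : Finset (Fin 5), X.Nonempty → X.card ≤ 3 → D X < B → D X ≤ 18 := by
    intro X hX hk hXB
    have := hD.le_add_card_filter (k := 2) (c := 11) hX hXB hk h₂ (by norm_num)
      (fun X => ¬ (p ∈ X ∧ q ∈ X)) fun X hX _ hXF => by
        rw [not_not] at hXF
        exact h₃' X hX.le hXF.1 hXF.2
    rwa [card_triples_not_merged_five p q hne] at this
  have h₄' : ∀ X : Finset (Fin 5), X.card ≤ 4 → p ∈ X → q ∈ X → D X ≤ 19 := fun X hX hpX hqX =>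
    hD.le_of_merge hg hYB (Finset.subset_univ X) hpX hqX hne hpq hX h₃
  have h₄ := hD.le_add_card_filter (k := 3) (c := 19) ⟨_, Finset.mem_image_of_mem g hp⟩ hYB
    (Nat.lt_succ_iff.1 (card_image_lt hp hq hne hpq)) h₃ (by norm_num)
    (fun X => ¬ (p ∈ X ∧ q ∈ X)) fun X hX _ hXF => by
      rw [not_not] at hXF
      exact h₄' X hX.le hXF.1 hXF.2
  rw [card_quadruples_not_merged p q hne] at h₄
  by_contra hcon
  set Y := Finset.univ.image g with hYdef
  have hYne : Y.Nonempty := ⟨_, Finset.mem_image_of_mem g hp⟩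
  have hcard : ∀ X : Finset (Fin 5), X.Nonempty → 19 ≤ D X → X.card ≤ 4 → X.card = 4 := by
    intro X hX h19 h4
    by_contra h
    have := h₃ X hX (by omega) (hfin X hX)
    omega
  have hY4 : Y.card = 4 := hcard Y hYne (by omega)
    (Nat.lt_succ_iff.1 (card_image_lt hp hq hne hpq))
  have hYpq : ¬ (p ∈ Y ∧ q ∈ Y) := fun h => by
    have := h₄' Y hY4.le h.1 h.2
    omega
  obtain ⟨R, hYR, hR⟩ := hD.exists_step Y (by omega) hYB
  have hRne := nonempty_of_isStep hYR hYne
  have hR4 : R.card = 4 := hcard R hRne (by omega) (hY4 ▸ card_le_of_isStep hYR)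
  have hRpq : ¬ (p ∈ R ∧ q ∈ R) := fun h => by
    have := h₄' R hR4.le h.1 h.2
    omega
  obtain ⟨_, ⟨f, rfl, hf⟩, hV⟩ := hD.exists_step R (by omega) (hfin R hRne)
  set V := R.image f with hVdef
  have hVne : V.Nonempty := hRne.image f
  have hV4 : V.card = 4 := hcard V hVne (by omega) (hR4 ▸ Finset.card_image_le)
  have hVpq : p ∈ V ∧ q ∈ V := by
    by_contra h
    have hsub : ({Y, R, V} : Finset (Finset (Fin 5))) ⊆
        Finset.univ.filter fun X => X.card = 4 ∧ ¬ (p ∈ X ∧ q ∈ X) := by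
      intro X hX
      simp only [Finset.mem_insert, Finset.mem_singleton] at hX
      rw [Finset.mem_filter]
      rcases hX with rfl | rfl | rfl
      · exact ⟨Finset.mem_univ _, hY4, hYpq⟩
      · exact ⟨Finset.mem_univ _, hR4, hRpq⟩
      · exact ⟨Finset.mem_univ _, hV4, h⟩
    have hle := Finset.card_le_card hsub
    rw [card_quadruples_not_merged p q hne, Finset.card_eq_three.2
      ⟨Y, R, V, fun h => by rw [h] at hR; omega, fun h => by rw [h] at hR; omega,
        fun h => by rw [← h] at hV; omega, rfl⟩] at hle
    omega
  obtain ⟨p', hp', hfp⟩ := Finset.mem_image.1 hVpq.1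
  obtain ⟨q', hq', hfq⟩ := Finset.mem_image.1 hVpq.2
  have hW := hg V (Finset.subset_univ V) hVne
  have := hD.le_add_card_filter (k := 2) (c := 12) (hVne.image g) (hfin _ (hVne.image g))
    (Nat.lt_succ_iff.1 ((card_image_lt hVpq.1 hVpq.2 hne hpq).trans_le hV4.le)) h₂ (by norm_num)
    (fun X => ¬ (p ∈ X ∧ q ∈ X) ∧ ¬ (X ⊆ R ∧ p' ∈ X ∧ q' ∈ X)) fun X hX _ hXF => by
      rw [not_and_or, not_not, not_not] at hXF
      rcases hXF with h | ⟨h, hpX, hqX⟩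
      · exact (h₃' X hX.le h.1 h.2).trans (by norm_num)
      · refine (hf X h ⟨_, hpX⟩).trans (Nat.succ_le_succ (h₃' _ ?_ ?_ ?_))
        · exact Finset.card_image_le.trans hX.le
        · exact hfp ▸ Finset.mem_image_of_mem f hpX
        · exact hfq ▸ Finset.mem_image_of_mem f hqX
  rw [card_triples_not_merged_twice R hR4 p q hne hRpq p' hp' q' hq'
    fun h => hne (by rw [← hfp, ← hfq, h])] at this
  omega

theorem le_of_quadruple_of_bound (hD : IsSyncRank B D) {S T : Finset (Fin 5)} (hS : S.card = 4)
    (hlt : D S < B) (hT : T.card = 3) (hTB : D T = B) : D S ≤ 21 := by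
  have hTne : T.Nonempty := Finset.card_pos.1 (by omega)
  have hnot : ∀ X, D X < B → ¬ T ⊆ X := fun X hX h => by
    have := hD.mono hTne h
    omega
  obtain ⟨W, hW, hmin⟩ := Finset.exists_min_image
    (Finset.univ.filter fun X : Finset (Fin 5) => X.card = 4) D ⟨S, by simp [hS]⟩
  simp only [Finset.mem_filter, Finset.mem_univ, true_and] at hW hmin
  have hWB : D W < B := (hmin S hS).trans_lt hlt
  obtain ⟨p, hp, q, hq, hne, g, hpq, hg, hY⟩ := hD.exists_merge (by omega) hWB fun Y hY => by
    have := hmin Y (hY.trans hW)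
    omega
  have hYB : D (W.image g) < B := by omega
  have h₂ : ∀ X : Finset (Fin 5), X.Nonempty → X.card ≤ 2 → D X < B → D X ≤ 10 :=
    fun X hX hk => hD.le_ten_of_pair hX hk
  have h := hD.le_add_card_filter (k := 2) (c := 11) ⟨_, Finset.mem_image_of_mem g hp⟩ hYB
    (Nat.lt_succ_iff.1 ((card_image_lt hp hq hne hpq).trans_le hW.le)) h₂ (by norm_num)
    (fun X => X ≠ T ∧ ¬ (X ⊆ W ∧ p ∈ X ∧ q ∈ X)) fun X hX hXB hXF => by
      rw [not_and_or, not_not, not_not] at hXF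
      rcases hXF with rfl | ⟨hXW, hpX, hqX⟩
      · omega
      · exact hD.le_of_merge hg hYB hXW hpX hqX hne hpq hX.le h₂
  rw [card_triples_ne T hT W hW (hnot W hWB) p hp q hq hne] at h
  have h' := hD.le_add_card_filter (k := 3) (b := 19) (c := 19)
    (Finset.card_pos.1 (by omega)) hlt hS.le (fun X hX hk hXB => by
      have := hD.lt_card_midSubsets hX hXB hk hTne hT.le hTB
      rw [card_midSubsets.2.2.2.2.2] at this
      omega) le_rfl (fun X => X ≠ W ∧ ¬ T ⊆ X) fun X _ hXB hXF => by
        rw [not_and_or, not_not, not_not] at hXF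
        rcases hXF with rfl | hTX
        · omega
        · exact absurd hTX (hnot X hXB)
  rwa [card_quadruples_ne T hT W hW (hnot W hWB)] at h'

end IsSyncRank

end SmallBounds

namespace SyncSearch

/-! ### Evaluation in the kernel

Natural numbers serve as bit sets. Functions in continuation-passing style evaluate their
intermediate results before the continuation uses them. -/

/-- `k n`, with `n` evaluated first. -/
noncomputable def force (n : ℕ) (k : ℕ → Bool) : Bool :=
  Nat.casesOn n (k 0) fun m => k (Nat.succ m)

/-- `k l`, with the entries of `l` evaluated first. -/
noncomputable def forceList : List ℕ → (List ℕ → Bool) → Bool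
  | [], k => k []
  | a :: l, k => force a fun a' => forceList l fun l' => k (a' :: l')

/-- The position of the first letter in a bit set of letters; lower bits carry no information. -/
abbrev offset : ℕ := 64

/-- Replaces the bits of `X` below `offset` by a hash of `X`. -/
noncomputable def mix (X : ℕ) : ℕ :=
  Nat.lor (Nat.shiftLeft (Nat.shiftRight X 64) 64) (Nat.mod X 1000000000000037)

noncomputable def forceMix (X : ℕ) (k : ℕ → Bool) : Bool := force X fun Y => force (mix Y) k

/-! ### Letters -/

/-- The code of the image of the set coded by `a` under the map with the given values. -/
noncomputable def imageCode : List ℕ → ℕ → ℕ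
  | [], _ => 0
  | j :: l, a => bif Nat.beq (Nat.land a 1) 0 then imageCode l (Nat.shiftRight a 1)
      else Nat.lor (Nat.shiftLeft 1 j) (imageCode l (Nat.shiftRight a 1))

/-- A letter defined on the set coded by `source`. -/
structure Letter where
  key : ℕ
  source : ℕ
  word : List ℕ
  target : ℕ

noncomputable def injectiveWords : ℕ → List (List ℕ)
  | 0 => [[]]
  | k + 1 => (injectiveWords k).flatMap fun l =>
      ([0, 1, 2, 3, 4].filter fun i => !l.contains i).map fun i => i :: l

noncomputable def shiftWords (i : ℕ) : List (List ℕ) :=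
  (injectiveWords 5).filter fun l => Nat.beq (l.getD (i + 1) 0) i

/-- The word sending `x` to `b`, `y` to `c` and all other states to `a`. -/
noncomputable def wordOfThree (x y a b c : ℕ) : List ℕ :=
  [0, 1, 2, 3, 4].map fun i => bif Nat.beq i x then b else bif Nat.beq i y then c else a

noncomputable def wordsOfThree (x y : ℕ) : List (List ℕ) :=
  (injectiveWords 3).map fun l => wordOfThree x y (l.getD 0 0) (l.getD 1 0) (l.getD 2 0)

/-- The triples `(p, q, r)` with `p < q < r < 5`. -/
noncomputable def tripleTable : List (ℕ × ℕ × ℕ) :=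
  [(0, 1, 2), (0, 1, 3), (0, 2, 3), (1, 2, 3), (0, 1, 4), (0, 2, 4), (1, 2, 4), (0, 3, 4),
    (1, 3, 4), (2, 3, 4)]

/-- The pairs `(x, y)` with `1 ≤ x < y < 5`. -/
noncomputable def mergeTable : List (ℕ × ℕ) := [(1, 2), (1, 3), (1, 4), (2, 3), (2, 4), (3, 4)]

noncomputable def tripleCode (t : ℕ × ℕ × ℕ) : ℕ := 2 ^ t.1 + 2 ^ t.2.1 + 2 ^ t.2.2

noncomputable def mergedCode (c : ℕ × ℕ) : ℕ := 30 - 2 ^ c.1 - 2 ^ c.2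

/-- Key, source and words of each group of letters. -/
noncomputable def groups : List (ℕ × ℕ × List (List ℕ)) :=
  [0, 1, 2, 3].map (fun i => (31 - 2 ^ (i + 1), 31 - 2 ^ (i + 1), shiftWords i)) ++
  tripleTable.map (fun t => (tripleCode t, tripleCode t, wordsOfThree t.2.1 t.2.2)) ++
  mergeTable.map (fun c => (mergedCode c, 30, wordsOfThree c.1 c.2))

noncomputable def letters : List Letter :=
  groups.flatMap fun g => g.2.2.map fun w => ⟨g.1, g.2.1, w, imageCode w g.2.1⟩

/-- One more than the largest position of a letter. -/
abbrev width : ℕ := 1120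

noncomputable def forceLetters : List Letter → (List Letter → Bool) → Bool
  | [], k => k []
  | ⟨key, src, w, t⟩ :: ls, k => force key fun key' => force src fun src' =>
      forceList w fun w' => force t fun t' => forceLetters ls fun ls' =>
        k (⟨key', src', w', t'⟩ :: ls')

/-- The positions of the letters with the given key. -/
noncomputable def segment (key : ℕ) : List Letter → ℕ → ℕ
  | [], _ => 0
  | ℓ :: ls, j => bif Nat.beq ℓ.key key then Nat.lor (Nat.shiftLeft 1 j) (segment key ls (j + 1))
      else segment key ls (j + 1)

/-! ### Items -/

/-- A set of states: its code, the positions of the letters starting from it, and a bit set with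
bit `width * c + j` set if letter `j` sends it to the set coded by `c`, and bit `j` set if it is
the target of letter `j`. -/
structure Item where
  code : ℕ
  row : ℕ
  seg : ℕ

noncomputable def addLetters (a : ℕ) : List Letter → ℕ → ℕ → (ℕ → Bool) → Bool
  | [], _, r, k => k r
  | ℓ :: ls, j, r, k =>
    force (Nat.succ j) fun j' =>
    force (bif Nat.beq ℓ.target a then Nat.lor r (Nat.shiftLeft 1 j) else r) fun r' =>
    force (bif Nat.beq (Nat.land a ℓ.source) a then
      Nat.lor r' (Nat.shiftLeft 1 (Nat.add (Nat.mul width (imageCode ℓ.word a)) j)) else r')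
      fun r'' => addLetters a ls j' r'' k

noncomputable def buildItems (ls : List Letter) : List ℕ → (List Item → Bool) → Bool
  | [], k => k []
  | a :: as, k => force a fun a' => addLetters a' ls offset a' fun r =>
      force (segment a' ls offset) fun s => buildItems ls as fun is => k (⟨a', r, s⟩ :: is)

noncomputable def dead (R : ℕ) (ss : List ℕ) : Bool :=
  List.rec false (fun s _ ih => Bool.rec ih true (Nat.beq (Nat.land R s) 0)) ss

/-- The letters sending the set with row `T` to one of the sets `bs`. -/
noncomputable def kill (T : ℕ) (bs : List Item) : ℕ :=
  List.rec 0 (fun b _ ih => Nat.lor (Nat.shiftRight T (Nat.mul width b.code)) ih) bs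

noncomputable def withKill (prev rest : List Item) :
    (List (Item × ℕ × ℕ) → ℕ → Bool) → Bool :=
  List.rec (fun k => k [] 0)
    (fun a _ ih k => forceMix (kill a.row prev) fun K => ih fun l S =>
      forceMix (Nat.lor K S) fun S' => k ((a, K, S') :: l) S') rest

noncomputable def diff (R K : ℕ) : ℕ := Nat.xor R (Nat.land R K)

/-- Branches over which elements of `l` belong to the current level; there are at most `b`. -/
noncomputable def branch (l : List (Item × ℕ × ℕ)) : ℕ → ℕ → List Item → List Item →
    (ℕ → List Item → List Item → Bool) → Bool :=
  List.rec (fun _ R B rest k => k R B rest)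
   (fun p l ih b R B rest k => Prod.rec (fun a p => Prod.rec (fun K S =>
    Nat.casesOn b (forceMix (diff R S) fun R' => k R' B (a :: l.map Prod.fst ++ rest))
     fun b' => Bool.rec false (forceMix (diff R K) fun R' => ih b R' B (a :: rest) k)
       (ih b' R (a :: B) rest k)) p) p) l

/-- Chooses the sets of the next level from `rest`, when `later` further levels follow. -/
noncomputable def level (segs : List ℕ) (prev init rest : List Item) (later R : ℕ)
    (k : ℕ → List Item → List Item → Bool) : Bool :=
  force (rest.length - later) fun b => withKill prev rest fun l _ =>
    branch l b R init [] fun R' B rest' =>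
      match B with
      | [] => true
      | b :: bs => Bool.rec (k R' (b :: bs) rest') true (dead R' segs)

noncomputable def rowUnion (l : List Item) : ℕ :=
  List.rec 0 (fun a _ ih => Nat.lor a.row ih) l

/-- Removes the letters in `s` whose target is not in `l`. -/
noncomputable def restrict (R s : ℕ) (l : List Item) : ℕ :=
  Nat.lor (diff R s) (Nat.land (Nat.land R s) (rowUnion l))

noncomputable def restrictAll (prev : List Item) :
    List Item → ℕ → List ℕ → (ℕ → List ℕ → Bool) → Bool
  | [], R, segs, k => k R segs
  | t :: ts, R, segs, k => forceMix (restrict R t.seg prev) fun R' =>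
      restrictAll prev ts R' (t.seg :: segs) k

noncomputable def placePairs (low : ℕ) (segs : List ℕ) : ℕ → ℕ → List Item → List Item → Bool
  | 0, _, _, _ => false
  | r + 1, R, prev, rest =>
    forceMix (diff R (kill low prev)) fun R' =>
    level segs prev [] rest r R' fun R'' B rest' => placePairs low segs r R'' B rest'

noncomputable def placeTriples (k : List Item → List ℕ → ℕ → Bool) :
    ℕ → ℕ → List Item → List Item → List ℕ → Bool
  | 0, R, prev, _, segs => k prev segs R
  | r + 1, R, prev, rest, segs =>
    level segs prev [] rest r R fun R' B rest' =>
      restrictAll prev B R' segs fun R'' segs' =>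
        Bool.rec (placeTriples k r R'' B rest' segs') true (dead R'' segs')

noncomputable def hasCode (l : List Item) (a : ℕ) : Bool := l.any fun b => Nat.beq b.code a

noncomputable def finishPairs (mseg D₂ : ℕ) (B₁ B₂ rest triples L top : List Item)
    (segs : List ℕ) (R : ℕ) : Bool :=
  forceMix (rowUnion (triples.filter fun a => !hasCode L a.code)) fun low =>
  forceMix (restrict R mseg top) fun R' =>
  forceMix (diff R' (kill low B₁)) fun R'' =>
    dead R'' segs || placePairs low segs (D₂ - 2) R'' B₂ rest

noncomputable def chooseLow :
    List Item → List Item → List Item → (List Item → List Item → Bool) → Bool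
  | [], B, M, k => k B M
  | a :: l, B, M, k => chooseLow l (a :: B) M k && chooseLow l B (a :: M) k

noncomputable def isLow (pq : ℕ) (a : Item) : Bool :=
  Nat.beq (Nat.land a.code pq) pq && Nat.beq (Nat.land a.code 1) 0

/-- Whether there are no values on pairs `1, …, D₂` and on triples `D₂ + 1, …, top`
consistent with the letters. -/
noncomputable def search (pq mseg D₂ top : ℕ) (segs : List ℕ) (full : ℕ)
    (pairs triples : List Item) : Bool :=
  level segs [] [] pairs (D₂ - 1) full fun R₁ B₁ rest₁ => !hasCode B₁ pq ||
  level segs B₁ [] rest₁ (D₂ - 2) R₁ fun R₂ B₂ rest₂ =>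
  chooseLow (triples.filter fun a => isLow pq a) [] [] fun L₁ M =>
  branch ((triples.filter fun a => !isLow pq a).map fun a => (a, 0, 0)) (9 - (top - D₂)) R₂ L₁ []
    fun R₃ L rest =>
    level segs L M rest (top - D₂ - 1) R₃ fun R B rest' =>
      placeTriples (finishPairs mseg D₂ B₁ B₂ rest₂ triples L) (top - D₂ - 1) R B rest' segs

noncomputable def pairCodes : List ℕ := [3, 5, 6, 9, 10, 12, 17, 18, 20, 24]

noncomputable def searchCase (ls : List Letter) (pairs triples : List Item) (pq D₂ top : ℕ) :
    Bool :=
  force pq fun pq' => force (segment pq' ls offset) fun mseg =>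
  forceList ((List.range (22 - top)).map fun i => segment (31 - 2 ^ (i + 1)) ls offset) fun s =>
  force (2 ^ width - 1) fun full => search pq' mseg D₂ top (mseg :: s) full pairs triples

noncomputable def searchAll : Bool :=
  forceLetters letters fun ls => buildItems ls pairCodes fun pairs =>
  buildItems ls (tripleTable.map tripleCode) fun triples =>
  mergeTable.all fun c => [(10, 19), (9, 18), (10, 18)].all fun v =>
    searchCase ls pairs triples (mergedCode c) v.1 v.2

/-! ### Values of the functions in continuation-passing style -/

theorem force_eq (n : ℕ) (k : ℕ → Bool) : force n k = k n := by cases n <;> rfl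

theorem forceList_eq (l : List ℕ) (k : List ℕ → Bool) : forceList l k = k l := by
  induction l generalizing k with
  | nil => rfl
  | cons a l ih => simp [forceList, force_eq, ih]

theorem forceMix_eq (X : ℕ) (k : ℕ → Bool) : forceMix X k = k (mix X) := by
  simp [forceMix, force_eq]

theorem testBit_lor (a b i : ℕ) : (Nat.lor a b).testBit i = (a.testBit i || b.testBit i) :=
  Nat.testBit_or a b i

theorem testBit_land (a b i : ℕ) : (Nat.land a b).testBit i = (a.testBit i && b.testBit i) :=
  Nat.testBit_and a b i

theorem testBit_shiftOne (i j : ℕ) : (Nat.shiftLeft 1 j).testBit i = decide (i = j) := by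
  change (1 <<< j).testBit i = _
  rw [Nat.one_shiftLeft, Nat.testBit_two_pow, decide_eq_decide, eq_comm]

theorem beq_eq_decide (m n : ℕ) : Nat.beq m n = decide (m = n) := by
  rw [Bool.eq_iff_iff, decide_eq_true_iff]
  exact ⟨Nat.eq_of_beq_eq_true, fun h => h ▸ Nat.beq_refl m⟩

theorem testBit_shiftRight' (a j i : ℕ) : (Nat.shiftRight a j).testBit i = a.testBit (j + i) :=
  Nat.testBit_shiftRight a

theorem testBit_diff (R K i : ℕ) : (diff R K).testBit i = (R.testBit i && !K.testBit i) := by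
  change (R ^^^ (R &&& K)).testBit i = _
  rw [Nat.testBit_xor, Nat.testBit_and]
  cases R.testBit i <;> cases K.testBit i <;> rfl

theorem testBit_mix {X j : ℕ} (h : offset ≤ j) : (mix X).testBit j = X.testBit j := by
  have hlt : (X % 1000000000000037).testBit j = false := by
    apply Nat.testBit_lt_two_pow
    calc X % 1000000000000037 < 1000000000000037 := Nat.mod_lt _ (by norm_num)
      _ ≤ 2 ^ 64 := by norm_num
      _ ≤ 2 ^ j := Nat.pow_le_pow_right (by norm_num) h
  change ((X >>> 64) <<< 64 ||| X % 1000000000000037).testBit j = _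
  rw [Nat.testBit_or, hlt, Nat.testBit_shiftLeft, Nat.testBit_shiftRight]
  have h' : 64 ≤ j := h
  simp [h']

theorem forceLetters_eq (ls : List Letter) (k : List Letter → Bool) : forceLetters ls k = k ls := by
  induction ls generalizing k with
  | nil => rfl
  | cons ℓ ls ih => cases ℓ; simp [forceLetters, force_eq, forceList_eq, ih]

/-- The row of the item with code `a`. -/
noncomputable def rowOf (a : ℕ) : List Letter → ℕ → ℕ → ℕ
  | [], _, r => r
  | ℓ :: ls, j, r =>
    let r' := bif Nat.beq ℓ.target a then Nat.lor r (Nat.shiftLeft 1 j) else r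
    rowOf a ls (j + 1) (bif Nat.beq (Nat.land a ℓ.source) a then
      Nat.lor r' (Nat.shiftLeft 1 (Nat.add (Nat.mul width (imageCode ℓ.word a)) j)) else r')

theorem addLetters_eq (a : ℕ) (ls : List Letter) (j r : ℕ) (k : ℕ → Bool) :
    addLetters a ls j r k = k (rowOf a ls j r) := by
  induction ls generalizing j r with
  | nil => rfl
  | cons ℓ ls ih => simp only [addLetters, rowOf, force_eq, ih]

theorem testBit_rowOf (a : ℕ) (ls : List Letter) (j r i : ℕ) :
    (rowOf a ls j r).testBit i = true ↔ r.testBit i = true ∨ ∃ x ℓ, ls[x]? = some ℓ ∧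
      (ℓ.target = a ∧ i = j + x ∨
        Nat.land a ℓ.source = a ∧ i = width * imageCode ℓ.word a + (j + x)) := by
  induction ls generalizing j r with
  | nil => simp [rowOf]
  | cons ℓ ls ih =>
    rw [rowOf, ih]
    have hsplit : ∀ Q : ℕ → Letter → Prop, (∃ x ℓ', (ℓ :: ls)[x]? = some ℓ' ∧ Q x ℓ') ↔
        Q 0 ℓ ∨ ∃ x ℓ', ls[x]? = some ℓ' ∧ Q (x + 1) ℓ' := by
      intro Q
      constructor
      · rintro ⟨x, ℓ', hx, hQ⟩
        cases x with
        | zero => simp at hx; subst hx; exact Or.inl hQ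
        | succ x => exact Or.inr ⟨x, ℓ', by simpa using hx, hQ⟩
      · rintro (hQ | ⟨x, ℓ', hx, hQ⟩)
        · exact ⟨0, ℓ, rfl, hQ⟩
        · exact ⟨x + 1, ℓ', by simpa using hx, hQ⟩
    rw [hsplit, ← or_assoc]
    refine or_congr ?_ (by simp only [Nat.add_comm, Nat.add_left_comm])
    simp only [beq_eq_decide]
    by_cases ht : ℓ.target = a <;> by_cases hs : Nat.land a ℓ.source = a <;>
      simp only [ht, hs, decide_true, decide_false, cond_true, cond_false, testBit_lor,
      testBit_shiftOne, Bool.or_eq_true, decide_eq_true_iff, true_and, false_and, or_false,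
      false_or, or_assoc, Nat.add_zero, Nat.add_eq, Nat.mul_eq]

theorem testBit_segment (key : ℕ) (ls : List Letter) (j i : ℕ) :
    (segment key ls j).testBit i = true ↔ ∃ x ℓ, ls[x]? = some ℓ ∧ ℓ.key = key ∧ i = j + x := by
  induction ls generalizing j with
  | nil => simp [segment]
  | cons ℓ ls ih =>
    have hsplit : (∃ x ℓ', (ℓ :: ls)[x]? = some ℓ' ∧ ℓ'.key = key ∧ i = j + x) ↔
        (ℓ.key = key ∧ i = j) ∨ ∃ x ℓ', ls[x]? = some ℓ' ∧ ℓ'.key = key ∧ i = j + 1 + x := by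
      constructor
      · rintro ⟨x, ℓ', hx, hQ⟩
        cases x with
        | zero => simp at hx; subst hx; exact Or.inl hQ
        | succ x => exact Or.inr ⟨x, ℓ', by simpa using hx, hQ.1, by omega⟩
      · rintro (hQ | ⟨x, ℓ', hx, hQ⟩)
        · exact ⟨0, ℓ, rfl, hQ⟩
        · exact ⟨x + 1, ℓ', by simpa using hx, hQ.1, by omega⟩
    rw [segment, hsplit, ← ih]
    rw [beq_eq_decide]
    by_cases ht : ℓ.key = key <;> simp only [ht, decide_true, decide_false, cond_true, cond_false, testBit_lor,
      testBit_shiftOne, Bool.or_eq_true, decide_eq_true_iff, true_and, false_and, false_or]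

noncomputable def itemOf (ls : List Letter) (a : ℕ) : Item :=
  ⟨a, rowOf a ls offset a, segment a ls offset⟩

theorem buildItems_eq (ls : List Letter) (as : List ℕ) (k : List Item → Bool) :
    buildItems ls as k = k (as.map (itemOf ls)) := by
  induction as generalizing k with
  | nil => rfl
  | cons a as ih => simp [buildItems, force_eq, addLetters_eq, ih, itemOf]

/-! ### Soundness of the search -/

/-- No element of `J` is in the bit set `K`. -/
def Avoids (J : Set ℕ) (K : ℕ) : Prop := ∀ j ∈ J, K.testBit j = false

/-- All elements of `J` are in the bit set `R`. -/
def Covers (J : Set ℕ) (R : ℕ) : Prop := ∀ j ∈ J, R.testBit j = true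

variable {J : Set ℕ} {R K : ℕ}

theorem Avoids.mix (hJ : ∀ j ∈ J, offset ≤ j) (h : Avoids J K) : Avoids J (mix K) :=
  fun j hj => (testBit_mix (hJ j hj)).trans (h j hj)

theorem Covers.mix (hJ : ∀ j ∈ J, offset ≤ j) (h : Covers J R) : Covers J (mix R) :=
  fun j hj => (testBit_mix (hJ j hj)).trans (h j hj)

theorem Covers.diff (h : Covers J R) (hK : Avoids J K) : Covers J (diff R K) := fun j hj => by
  rw [testBit_diff, h j hj, hK j hj]; rfl

theorem Avoids.lor {L : ℕ} (hK : Avoids J K) (hL : Avoids J L) : Avoids J (Nat.lor K L) :=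
  fun j hj => by rw [testBit_lor, hK j hj, hL j hj]; rfl

theorem testBit_rowUnion (l : List Item) (i : ℕ) :
    (rowUnion l).testBit i = true ↔ ∃ a ∈ l, a.row.testBit i = true := by
  induction l with
  | nil => simp [rowUnion]
  | cons a l ih =>
    change (Nat.lor a.row (rowUnion l)).testBit i = true ↔ _
    rw [testBit_lor, Bool.or_eq_true, ih]
    simp

theorem Covers.restrict {s : ℕ} {l : List Item} (h : Covers J R)
    (hs : ∀ j ∈ J, s.testBit j = true → ∃ a ∈ l, a.row.testBit j = true) :
    Covers J (restrict R s l) := fun j hj => by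
  rw [SyncSearch.restrict, testBit_lor, testBit_diff, testBit_land, testBit_land, h j hj]
  cases hsj : s.testBit j
  · rfl
  · simpa using (testBit_rowUnion l j).2 (hs j hj hsj)

theorem testBit_kill (T : ℕ) (bs : List Item) (i : ℕ) :
    (kill T bs).testBit i = true ↔ ∃ b ∈ bs, T.testBit (width * b.code + i) = true := by
  induction bs with
  | nil => simp [kill]
  | cons b bs ih =>
    change (Nat.lor (Nat.shiftRight T (Nat.mul width b.code)) (kill T bs)).testBit i = true ↔ _
    rw [testBit_lor, Bool.or_eq_true, ih, testBit_shiftRight']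
    simp

theorem avoids_kill {T : ℕ} {bs : List Item}
    (h : ∀ j ∈ J, ∀ b ∈ bs, T.testBit (width * b.code + j) = true → False) :
    Avoids J (kill T bs) := fun j hj => by
  rw [Bool.eq_false_iff]
  intro ht
  obtain ⟨b, hb, ht⟩ := (testBit_kill T bs j).1 ht
  exact h j hj b hb ht

theorem dead_eq_false (h : Covers J R) {ss : List ℕ}
    (hs : ∀ s ∈ ss, ∃ j ∈ J, s.testBit j = true) : dead R ss = false := by
  induction ss with
  | nil => rfl
  | cons s ss ih =>
    have hne : Nat.beq (Nat.land R s) 0 = false := by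
      obtain ⟨j, hj, hsj⟩ := hs s List.mem_cons_self
      rw [beq_eq_decide, decide_eq_false_iff_not]
      intro h0
      have := testBit_land R s j
      rw [h0, h j hj, hsj] at this
      simp at this
    change (Bool.rec (dead R ss) true (Nat.beq (Nat.land R s) 0) : Bool) = false
    rw [hne]
    exact ih fun t ht => hs t (List.mem_cons_of_mem s ht)

/-- The masks in `l` avoid `J` if the elements satisfying `P` belong to the current level. -/
def Valid (J : Set ℕ) (P : Item → Prop) : List (Item × ℕ × ℕ) → Prop
  | [] => True
  | x :: l => (¬ P x.1 → Avoids J x.2.1) ∧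
      ((∀ y ∈ x :: l, ¬ P y.1) → Avoids J x.2.2) ∧ Valid J P l

theorem withKill_spec (hJ : ∀ j ∈ J, offset ≤ j) {P : Item → Prop} {prev rest : List Item}
    (h : ∀ a ∈ rest, ¬ P a → Avoids J (kill a.row prev)) :
    ∃ l S, (∀ k, withKill prev rest k = k l S) ∧ l.map Prod.fst = rest ∧ Valid J P l ∧
      ((∀ a ∈ rest, ¬ P a) → Avoids J S) := by
  induction rest with
  | nil => exact ⟨[], 0, fun _ => rfl, rfl, trivial, fun _ j _ => Nat.zero_testBit j⟩
  | cons a rest ih =>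
    obtain ⟨l, S, hk, hl, hv, hS⟩ := ih fun b hb => h b (List.mem_cons_of_mem a hb)
    have ha : ¬ P a → Avoids J (mix (kill a.row prev)) := fun hP =>
      (h a List.mem_cons_self hP).mix hJ
    have hS' : (∀ b ∈ a :: rest, ¬ P b) →
        Avoids J (mix (Nat.lor (mix (kill a.row prev)) S)) := fun hP =>
      ((ha (hP a List.mem_cons_self)).lor
        (hS fun b hb => hP b (List.mem_cons_of_mem a hb))).mix hJ
    refine ⟨(a, mix (kill a.row prev), mix (Nat.lor (mix (kill a.row prev)) S)) :: l, _,
      fun k => ?_, by rw [List.map_cons, hl], ⟨ha, ?_, hv⟩, hS'⟩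
    · change forceMix (kill a.row prev) (fun K => withKill prev rest fun l S =>
        forceMix (Nat.lor K S) fun S' => k ((a, K, S') :: l) S') = _
      rw [forceMix_eq, hk, forceMix_eq]
    · intro hP
      refine hS' fun b hb => ?_
      rw [List.mem_cons, ← hl, List.mem_map] at hb
      rcases hb with rfl | ⟨y, hy, rfl⟩
      · exact hP _ List.mem_cons_self
      · exact hP y (List.mem_cons_of_mem _ hy)

theorem exists_of_branch (hJ : ∀ j ∈ J, offset ≤ j) (P : Item → Prop) [DecidablePred P]
    {k : ℕ → List Item → List Item → Bool} {l : List (Item × ℕ × ℕ)} {b : ℕ}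
    {B rest : List Item} (h : branch l b R B rest k = true) (hv : Valid J P l)
    (hb : l.countP (fun x => P x.1) ≤ b) (hR : Covers J R) :
    ∃ R' B' rest', k R' B' rest' = true ∧ Covers J R' ∧
      (∀ a, a ∈ B' ↔ a ∈ B ∨ a ∈ l.map Prod.fst ∧ P a) ∧
      (∀ a, a ∈ rest' ↔ a ∈ rest ∨ a ∈ l.map Prod.fst ∧ ¬ P a) := by
  induction l generalizing b R B rest with
  | nil => exact ⟨R, B, rest, h, hR, by simp, by simp⟩
  | cons x l ih =>
    obtain ⟨a, K, S⟩ := x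
    obtain ⟨hK, hS, hv⟩ := hv
    cases b with
    | zero =>
      have hP : ∀ y ∈ (a, K, S) :: l, ¬ P y.1 := by
        simpa using List.countP_eq_zero.1 (Nat.le_zero.1 hb)
      change forceMix (diff R S) (fun R' => k R' B (a :: l.map Prod.fst ++ rest)) = true at h
      rw [forceMix_eq] at h
      refine ⟨_, _, _, h, (hR.diff (hS hP)).mix hJ, fun c => ?_, fun c => ?_⟩
      · have : c ∈ ((a, K, S) :: l).map Prod.fst → ¬ P c := by
          intro hc
          obtain ⟨y, hy, rfl⟩ := List.mem_map.1 hc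
          exact hP y hy
        tauto
      · have : c ∈ ((a, K, S) :: l).map Prod.fst → ¬ P c := by
          intro hc
          obtain ⟨y, hy, rfl⟩ := List.mem_map.1 hc
          exact hP y hy
        have h2 : c ∈ a :: l.map Prod.fst ++ rest ↔
            c ∈ ((a, K, S) :: l).map Prod.fst ∨ c ∈ rest := by
          simp [or_assoc]
        tauto
    | succ b =>
      change (Bool.rec false (forceMix (diff R K) fun R' => branch l (b + 1) R' B (a :: rest) k)
        (branch l b R (a :: B) rest k) : Bool) = true at h
      rw [forceMix_eq] at h
      have hc : ∀ (u v : Bool), (Bool.rec false u v : Bool) = true → u = true ∧ v = true := by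
        decide
      obtain ⟨h1, h2⟩ := hc _ _ h
      rw [List.countP_cons] at hb
      by_cases hP : P a
      · rw [if_pos (by simpa using hP)] at hb
        obtain ⟨R', B', rest', hk, hR', hB', hr'⟩ := ih h2 hv (by omega) hR
        refine ⟨R', B', rest', hk, hR', fun c => ?_, fun c => ?_⟩
        · rw [hB', List.map_cons, List.mem_cons, List.mem_cons]
          have : c = a → P c := fun h => h ▸ hP
          tauto
        · rw [hr', List.map_cons, List.mem_cons]
          have : c = a → P c := fun h => h ▸ hP
          tauto
      · obtain ⟨R', B', rest', hk, hR', hB', hr'⟩ := ih h1 hv (by omega)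
          ((hR.diff (hK hP)).mix hJ)
        refine ⟨R', B', rest', hk, hR', fun c => ?_, fun c => ?_⟩
        · rw [hB', List.map_cons, List.mem_cons]
          have : c = a → ¬ P c := fun h => h ▸ hP
          tauto
        · rw [hr', List.map_cons, List.mem_cons, List.mem_cons]
          have : c = a → ¬ P c := fun h => h ▸ hP
          tauto

theorem exists_of_level (hJ : ∀ j ∈ J, offset ≤ j) (P : Item → Prop) {segs : List ℕ}
    {prev init rest : List Item} {later : ℕ} {k : ℕ → List Item → List Item → Bool}
    (h : level segs prev init rest later R k = true)
    (hsegs : ∀ s ∈ segs, ∃ j ∈ J, s.testBit j = true)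
    (hkill : ∀ a ∈ rest, ¬ P a → Avoids J (kill a.row prev)) (Q : Finset Item)
    (hQ : ∀ a ∈ Q, a ∈ rest ∧ ¬ P a) (hcard : later ≤ Q.card)
    (hne : ∃ a, a ∈ init ∨ a ∈ rest ∧ P a) (hR : Covers J R) :
    ∃ R' B' rest', k R' B' rest' = true ∧ Covers J R' ∧
      (∀ a, a ∈ B' ↔ a ∈ init ∨ a ∈ rest ∧ P a) ∧ (∀ a, a ∈ rest' ↔ a ∈ rest ∧ ¬ P a) := by
  classical
  obtain ⟨l, S, hk, hl, hv, -⟩ := withKill_spec hJ hkill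
  rw [level, force_eq, hk] at h
  have hcount : l.countP (fun x => P x.1) ≤ rest.length - later := by
    have h1 : l.countP (fun x => P x.1) = rest.countP (fun a => P a) := by
      rw [← hl, List.countP_map]; rfl
    have h2 : Q.card ≤ rest.countP (fun a => ¬ P a) := by
      rw [List.countP_eq_length_filter]
      refine (Finset.card_le_card fun a ha => ?_).trans (List.toFinset_card_le _)
      rw [List.mem_toFinset, List.mem_filter]
      simpa using hQ a ha
    have h3 := List.length_eq_countP_add_countP (fun a => decide (P a)) (l := rest)
    have h4 : rest.countP (fun a => ¬ P a) = rest.countP (fun a => ¬ (decide (P a) = true)) := by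
      simp
    omega
  obtain ⟨R', B', rest', hk', hR', hB', hr'⟩ := exists_of_branch hJ P h hv hcount hR
  rw [hl] at hB' hr'
  refine ⟨R', B', rest', ?_, hR', hB', by simpa using hr'⟩
  cases B' with
  | nil =>
    obtain ⟨a, ha⟩ := hne
    exact absurd ((hB' a).2 ha) List.not_mem_nil
  | cons b bs =>
    change (Bool.rec (k R' (b :: bs) rest') true (dead R' segs) : Bool) = true at hk'
    rwa [dead_eq_false hR' hsegs] at hk'
/-- The letters in `J` sending `a` to the set coded by `c` are consistent with the values `d`. -/
structure IsConsistent (d : ℕ → ℕ) (J : Set ℕ) (a : Item) : Prop where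
  code_ne_zero : a.code ≠ 0
  le_succ : ∀ j ∈ J, ∀ c ≠ 0, a.row.testBit (width * c + j) = true → d a.code ≤ d c + 1

variable {d : ℕ → ℕ}

theorem exists_finset_levels {l : List Item} {v w : ℕ}
    (h : ∀ u, v < u → u ≤ w → ∃ a ∈ l, d a.code = u) :
    ∃ Q : Finset Item, (∀ a ∈ Q, a ∈ l ∧ v < d a.code) ∧ w - v ≤ Q.card := by
  classical
  have h' : ∀ u : Finset.Ioc v w, ∃ a ∈ l, d a.code = u := fun u =>
    h u (Finset.mem_Ioc.1 u.2).1 (Finset.mem_Ioc.1 u.2).2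
  choose f hf hd using h'
  refine ⟨Finset.univ.image f, ?_, ?_⟩
  · intro a ha
    obtain ⟨u, -, rfl⟩ := Finset.mem_image.1 ha
    exact ⟨hf u, by rw [hd]; exact (Finset.mem_Ioc.1 u.2).1⟩
  · rw [Finset.card_image_of_injective _ fun u u' huu => Subtype.ext (by rw [← hd, huu, hd])]
    simp

theorem exists_of_level_eq (hJ : ∀ j ∈ J, offset ≤ j) {segs : List ℕ}
    {prev init rest : List Item} (all : List Item) {later : ℕ} (v : ℕ)
    {k : ℕ → List Item → List Item → Bool}
    (h : level segs prev init rest later R k = true)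
    (hsegs : ∀ s ∈ segs, ∃ j ∈ J, s.testBit j = true) (hall : ∀ a ∈ all, IsConsistent d J a)
    (hrest : ∀ a, a ∈ rest ↔ a ∈ all ∧ v ≤ d a.code)
    (hprev : ∀ b ∈ prev, b.code ≠ 0 ∧ d b.code + 1 ≤ v)
    (hlev : ∀ u, v < u → u ≤ v + later → ∃ a ∈ all, d a.code = u)
    (hne : ∃ a, a ∈ init ∨ a ∈ all ∧ d a.code = v) (hR : Covers J R) :
    ∃ R' B' rest', k R' B' rest' = true ∧ Covers J R' ∧
      (∀ a, a ∈ B' ↔ a ∈ init ∨ a ∈ all ∧ d a.code = v) ∧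
      (∀ a, a ∈ rest' ↔ a ∈ all ∧ v + 1 ≤ d a.code) := by
  obtain ⟨Q, hQ, hcard⟩ := exists_finset_levels hlev
  have hiff : ∀ a, a ∈ rest ∧ d a.code = v ↔ a ∈ all ∧ d a.code = v := fun a => by
    rw [hrest]
    exact ⟨fun h => ⟨h.1.1, h.2⟩, fun h => ⟨⟨h.1, h.2.ge⟩, h.2⟩⟩
  obtain ⟨R', B', rest', hk, hR', hB, hr⟩ := exists_of_level hJ (fun a => d a.code = v) h hsegs
    (fun a ha hne => avoids_kill fun j hj b hb ht => by
      have h1 := ((hall a ((hrest a).1 ha).1).le_succ j hj b.code (hprev b hb).1 ht)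
      have h2 := (hprev b hb).2
      have h3 := ((hrest a).1 ha).2
      omega)
    Q (fun a ha => ⟨(hrest a).2 ⟨(hQ a ha).1, (hQ a ha).2.le⟩, (hQ a ha).2.ne'⟩)
    (by omega) (by simpa only [hiff] using hne) hR
  refine ⟨R', B', rest', hk, hR', by simpa only [hiff] using hB, fun a => ?_⟩
  rw [hr, hrest, and_assoc]
  exact and_congr_right fun _ => by omega

theorem exists_of_chooseLow (P : Item → Prop) {l B M : List Item}
    {k : List Item → List Item → Bool} (h : chooseLow l B M k = true) :
    ∃ B' M', k B' M' = true ∧ (∀ a, a ∈ B' ↔ a ∈ B ∨ a ∈ l ∧ P a) ∧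
      (∀ a, a ∈ M' ↔ a ∈ M ∨ a ∈ l ∧ ¬ P a) := by
  induction l generalizing B M with
  | nil => exact ⟨B, M, h, by simp, by simp⟩
  | cons b l ih =>
    rw [chooseLow, Bool.and_eq_true] at h
    by_cases hP : P b
    · obtain ⟨B', M', hk, hB, hM⟩ := ih h.1
      refine ⟨B', M', hk, fun a => ?_, fun a => ?_⟩
      · have : a = b → P a := fun h => h ▸ hP
        rw [hB, List.mem_cons, List.mem_cons]
        tauto
      · have : a = b → P a := fun h => h ▸ hP
        rw [hM, List.mem_cons]
        tauto
    · obtain ⟨B', M', hk, hB, hM⟩ := ih h.2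
      refine ⟨B', M', hk, fun a => ?_, fun a => ?_⟩
      · have : a = b → ¬ P a := fun h => h ▸ hP
        rw [hB, List.mem_cons]
        tauto
      · have : a = b → ¬ P a := fun h => h ▸ hP
        rw [hM, List.mem_cons, List.mem_cons]
        tauto

theorem exists_of_restrictAll (hJ : ∀ j ∈ J, offset ≤ j) {prev ts : List Item}
    {segs : List ℕ} {k : ℕ → List ℕ → Bool} (h : restrictAll prev ts R segs k = true)
    (hts : ∀ t ∈ ts, (∃ j ∈ J, t.seg.testBit j = true) ∧
      ∀ j ∈ J, t.seg.testBit j = true → ∃ a ∈ prev, a.row.testBit j = true)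
    (hsegs : ∀ s ∈ segs, ∃ j ∈ J, s.testBit j = true) (hR : Covers J R) :
    ∃ R' segs', k R' segs' = true ∧ (∀ s ∈ segs', ∃ j ∈ J, s.testBit j = true) ∧
      Covers J R' := by
  induction ts generalizing R segs with
  | nil => exact ⟨R, segs, h, hsegs, hR⟩
  | cons t ts ih =>
    rw [restrictAll, forceMix_eq] at h
    have ht := hts t List.mem_cons_self
    refine ih h (fun s hs => hts s (List.mem_cons_of_mem t hs)) ?_ ((hR.restrict ht.2).mix hJ)
    intro s hs
    rcases List.mem_cons.1 hs with rfl | hs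
    · exact ht.1
    · exact hsegs s hs

theorem placePairs_eq_false (hJ : ∀ j ∈ J, offset ≤ j) {low : ℕ} {segs : List ℕ}
    (hsegs : ∀ s ∈ segs, ∃ j ∈ J, s.testBit j = true) {pairs : List Item}
    (hpairs : ∀ a ∈ pairs, IsConsistent d J a) {r v : ℕ} {prev rest : List Item}
    (hlow : ∀ b ∈ pairs, d b.code < v + r → ∀ j ∈ J,
      low.testBit (width * b.code + j) = true → False)
    (hlev : ∀ u, v < u → u ≤ v + r → ∃ a ∈ pairs, d a.code = u)
    (hprev : ∀ a ∈ prev, a ∈ pairs ∧ d a.code = v)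
    (hrest : ∀ a, a ∈ rest ↔ a ∈ pairs ∧ v + 1 ≤ d a.code) (hR : Covers J R) :
    placePairs low segs r R prev rest = false := by
  induction r generalizing v R prev rest with
  | zero => rfl
  | succ r ih =>
    rw [Bool.eq_false_iff]
    intro h
    rw [placePairs, forceMix_eq] at h
    have hR' : Covers J (mix (diff R (kill low prev))) := by
      refine (hR.diff (avoids_kill fun j hj b hb => ?_)).mix hJ
      exact hlow b (hprev b hb).1 (by have := (hprev b hb).2; omega) j hj
    obtain ⟨R'', B, rest', hk, hR'', hB, hr⟩ := exists_of_level_eq hJ pairs (v + 1) h hsegs hpairs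
      hrest (fun b hb => ⟨(hpairs b (hprev b hb).1).code_ne_zero, by rw [(hprev b hb).2]⟩)
      (fun u hu hu' => hlev u (by omega) (by omega))
      (by obtain ⟨a, ha, hd⟩ := hlev (v + 1) (by omega) (by omega)
          exact ⟨a, Or.inr ⟨ha, hd⟩⟩) hR'
    rw [ih (v := v + 1) (by rwa [show v + 1 + r = v + (r + 1) by omega])
      (fun u hu hu' => hlev u (by omega) (by omega))
      (fun a ha => by simpa using (hB a).1 ha) hr hR''] at hk
    exact Bool.false_ne_true hk

theorem exists_of_placeTriples (hJ : ∀ j ∈ J, offset ≤ j) {triples : List Item}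
    (htriples : ∀ a ∈ triples, IsConsistent d J a) {r v : ℕ} {prev rest : List Item}
    {segs : List ℕ} {k : List Item → List ℕ → ℕ → Bool}
    (h : placeTriples k r R prev rest segs = true)
    (hstep : ∀ t ∈ triples, v < d t.code → d t.code ≤ v + r →
      (∃ j ∈ J, t.seg.testBit j = true) ∧ ∀ j ∈ J, t.seg.testBit j = true →
        ∃ b ∈ triples, b.row.testBit j = true ∧ d b.code + 1 = d t.code)
    (hlev : ∀ u, v < u → u ≤ v + r → ∃ a ∈ triples, d a.code = u)
    (hprev : ∀ a, a ∈ prev ↔ a ∈ triples ∧ d a.code = v)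
    (hrest : ∀ a, a ∈ rest ↔ a ∈ triples ∧ v + 1 ≤ d a.code)
    (hsegs : ∀ s ∈ segs, ∃ j ∈ J, s.testBit j = true) (hR : Covers J R) :
    ∃ R' prev' segs', k prev' segs' R' = true ∧ Covers J R' ∧
      (∀ s ∈ segs', ∃ j ∈ J, s.testBit j = true) ∧
      (∀ a, a ∈ prev' ↔ a ∈ triples ∧ d a.code = v + r) := by
  induction r generalizing v R prev rest segs with
  | zero => exact ⟨R, prev, segs, h, hR, hsegs, hprev⟩
  | succ r ih =>
    rw [placeTriples] at h
    obtain ⟨R', B, rest', hk, hR', hB, hr⟩ := exists_of_level_eq hJ triples (v + 1) h hsegs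
      htriples hrest (fun b hb => ⟨(htriples b ((hprev b).1 hb).1).code_ne_zero,
        by rw [((hprev b).1 hb).2]⟩)
      (fun u hu hu' => hlev u (by omega) (by omega))
      (by obtain ⟨a, ha, hd⟩ := hlev (v + 1) (by omega) (by omega)
          exact ⟨a, Or.inr ⟨ha, hd⟩⟩) hR
    replace hB : ∀ a, a ∈ B ↔ a ∈ triples ∧ d a.code = v + 1 := by simpa using hB
    obtain ⟨R'', segs', hk, hsegs', hR''⟩ := exists_of_restrictAll hJ hk (fun t ht => by
      obtain ⟨ht, hdt⟩ := (hB t).1 ht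
      obtain ⟨h1, h2⟩ := hstep t ht (by omega) (by omega)
      refine ⟨h1, fun j hj hs => ?_⟩
      obtain ⟨b, hb, hrow, hd⟩ := h2 j hj hs
      exact ⟨b, (hprev b).2 ⟨hb, by omega⟩, hrow⟩) hsegs hR'
    rw [dead_eq_false hR'' hsegs'] at hk
    have := ih hk (fun t ht h1 h2 => hstep t ht (by omega) (by omega))
      (fun u hu hu' => hlev u (by omega) (by omega)) hB hr hsegs' hR''
    rwa [show v + 1 + r = v + (r + 1) by omega] at this

theorem finishPairs_eq_false (hJ : ∀ j ∈ J, offset ≤ j) {mseg D₂ top : ℕ}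
    {B₁ B₂ rest pairs triples L tops : List Item} {segs : List ℕ} (hD₂ : 2 ≤ D₂)
    (hpairs : ∀ a ∈ pairs, IsConsistent d J a) (htriples : ∀ a ∈ triples, IsConsistent d J a)
    (hsegs : ∀ s ∈ segs, ∃ j ∈ J, s.testBit j = true)
    (hlev : ∀ u, 2 < u → u ≤ D₂ → ∃ a ∈ pairs, d a.code = u)
    (hB₁ : ∀ a ∈ B₁, a ∈ pairs ∧ d a.code = 1) (hB₂ : ∀ a ∈ B₂, a ∈ pairs ∧ d a.code = 2)
    (hrest : ∀ a, a ∈ rest ↔ a ∈ pairs ∧ 3 ≤ d a.code)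
    (hL : ∀ a, a ∈ triples → d a.code ≤ D₂ → a ∈ L)
    (htops : ∀ a, a ∈ triples → d a.code = top → a ∈ tops)
    (hmerge : ∀ j ∈ J, mseg.testBit j = true →
      ∃ b ∈ triples, b.row.testBit j = true ∧ d b.code = top) (hR : Covers J R) :
    finishPairs mseg D₂ B₁ B₂ rest triples L tops segs R = false := by
  rw [finishPairs, forceMix_eq, forceMix_eq, forceMix_eq]
  generalize hl : mix (rowUnion (triples.filter fun a => !hasCode L a.code)) = low
  have hlow : ∀ b ∈ pairs, d b.code < D₂ → ∀ j ∈ J,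
      low.testBit (width * b.code + j) = true → False := by
    intro b hb hd j hj ht
    have := hJ j hj
    rw [← hl, testBit_mix (by omega), testBit_rowUnion] at ht
    obtain ⟨a, ha, ht⟩ := ht
    rw [List.mem_filter] at ha
    have hle := (htriples a ha.1).le_succ j hj b.code (hpairs b hb).code_ne_zero ht
    have : hasCode L a.code = true := by
      rw [hasCode, List.any_eq_true]
      exact ⟨a, hL a ha.1 (by omega), Nat.beq_refl _⟩
    simp [this] at ha
  have hR' : Covers J (mix (diff (mix (restrict R mseg tops)) (kill low B₁))) := by
    refine (((hR.restrict fun j hj hs => ?_).mix hJ).diff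
      (avoids_kill fun j hj b hb => ?_)).mix hJ
    · obtain ⟨b, hb, hrow, hd⟩ := hmerge j hj hs
      exact ⟨b, htops b hb hd, hrow⟩
    · exact hlow b (hB₁ b hb).1 (by have := (hB₁ b hb).2; omega) j hj
  rw [dead_eq_false hR' hsegs, Bool.false_or]
  refine placePairs_eq_false hJ hsegs hpairs (v := 2) ?_ ?_ hB₂ hrest hR'
  · rwa [Nat.add_sub_cancel' hD₂]
  · rwa [Nat.add_sub_cancel' hD₂]

theorem search_eq_false (hJ : ∀ j ∈ J, offset ≤ j) {pq mseg D₂ top full : ℕ}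
    {pairs triples : List Item} {segs : List ℕ} (hD₂ : 2 ≤ D₂) (htop : D₂ < top)
    (hpairs : ∀ a ∈ pairs, IsConsistent d J a) (htriples : ∀ a ∈ triples, IsConsistent d J a)
    (hsegs : ∀ s ∈ segs, ∃ j ∈ J, s.testBit j = true) (hfull : Covers J full)
    (hpos : ∀ a ∈ pairs, 1 ≤ d a.code)
    (hpq : ∃ a ∈ pairs, a.code = pq ∧ d a.code = 1)
    (hlev₂ : ∀ u, 1 ≤ u → u ≤ D₂ → ∃ a ∈ pairs, d a.code = u)
    (hlev₃ : ∀ u, D₂ < u → u ≤ top → ∃ a ∈ triples, d a.code = u)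
    (hlow : ∀ a ∈ triples, isLow pq a = true → d a.code ≤ D₂ + 1)
    (hlen : (triples.filter fun a => !isLow pq a).length ≤ 8)
    (hstep : ∀ t ∈ triples, D₂ + 1 < d t.code → d t.code ≤ top →
      (∃ j ∈ J, t.seg.testBit j = true) ∧ ∀ j ∈ J, t.seg.testBit j = true →
        ∃ b ∈ triples, b.row.testBit j = true ∧ d b.code + 1 = d t.code)
    (hmerge : ∀ j ∈ J, mseg.testBit j = true →
      ∃ b ∈ triples, b.row.testBit j = true ∧ d b.code = top) :
    search pq mseg D₂ top segs full pairs triples = false := by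
  rw [Bool.eq_false_iff]
  intro h
  obtain ⟨a₁, ha₁, rfl, hd₁⟩ := hpq
  obtain ⟨R₁, B₁, rest₁, h, hR₁, hB₁, hr₁⟩ := exists_of_level_eq hJ pairs 1 h hsegs hpairs
    (fun a => ⟨fun ha => ⟨ha, hpos a ha⟩, fun ha => ha.1⟩) (by simp)
    (fun u hu hu' => hlev₂ u (by omega) (by omega)) ⟨a₁, Or.inr ⟨ha₁, hd₁⟩⟩ hfull
  replace hB₁ : ∀ a, a ∈ B₁ ↔ a ∈ pairs ∧ d a.code = 1 := by simpa using hB₁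
  have hcode : hasCode B₁ a₁.code = true := by
    rw [hasCode, List.any_eq_true]
    exact ⟨a₁, (hB₁ a₁).2 ⟨ha₁, hd₁⟩, Nat.beq_refl _⟩
  rw [hcode, Bool.not_true, Bool.false_or] at h
  obtain ⟨R₂, B₂, rest₂, h, hR₂, hB₂, hr₂⟩ := exists_of_level_eq hJ pairs 2 h hsegs hpairs hr₁
    (fun b hb => ⟨(hpairs b ((hB₁ b).1 hb).1).code_ne_zero, by rw [((hB₁ b).1 hb).2]⟩)
    (fun u hu hu' => hlev₂ u (by omega) (by omega))
    (by obtain ⟨a, ha, hd⟩ := hlev₂ 2 (by omega) hD₂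
        exact ⟨a, Or.inr ⟨ha, hd⟩⟩) hR₁
  replace hB₂ : ∀ a, a ∈ B₂ ↔ a ∈ pairs ∧ d a.code = 2 := by simpa using hB₂
  obtain ⟨L₁, M, h, hL₁, hM⟩ := exists_of_chooseLow (fun a => d a.code ≤ D₂) h
  have hhigh : ∀ u, D₂ + 1 < u → u ≤ top →
      ∃ a ∈ triples.filter fun a => !isLow a₁.code a, d a.code = u := by
    intro u hu hu'
    obtain ⟨a, ha, hd⟩ := hlev₃ u (by omega) hu'
    refine ⟨a, ?_, hd⟩
    rw [List.mem_filter]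
    refine ⟨ha, ?_⟩
    cases hl : isLow a₁.code a
    · rfl
    · have := hlow a ha hl
      omega
  have hcount : ((triples.filter fun a => !isLow a₁.code a).map
      fun a => (a, 0, 0)).countP (fun x : Item × ℕ × ℕ => d x.1.code ≤ D₂) ≤ 9 - (top - D₂) := by
    obtain ⟨Q, hQ, hcard⟩ := exists_finset_levels hhigh
    rw [List.countP_map]
    generalize triples.filter (fun a => !isLow a₁.code a) = l at *
    have h2 : Q.card ≤ l.countP (fun a => ¬ d a.code ≤ D₂) := by
      classical
      rw [List.countP_eq_length_filter]
      refine (Finset.card_le_card fun a ha => ?_).trans (List.toFinset_card_le _)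
      rw [List.mem_toFinset, List.mem_filter]
      have := hQ a ha
      exact ⟨this.1, by simpa using (by omega : D₂ < d a.code)⟩
    have h3 := List.length_eq_countP_add_countP (fun a : Item => decide (d a.code ≤ D₂)) (l := l)
    have h4 : l.countP (fun a => ¬ d a.code ≤ D₂) =
        l.countP (fun a => ¬ (decide (d a.code ≤ D₂) = true)) := by
      simp
    have h5 : l.countP ((fun x : Item × ℕ × ℕ => decide (d x.1.code ≤ D₂)) ∘
        fun a => (a, 0, 0)) = l.countP (fun a => decide (d a.code ≤ D₂)) := rfl
    omega
  have hvalid : ∀ l : List Item, Valid J (fun a => d a.code ≤ D₂) (l.map fun a => (a, 0, 0)) := by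
    intro l
    induction l with
    | nil => trivial
    | cons a l ih =>
      exact ⟨fun _ j _ => Nat.zero_testBit j, fun _ j _ => Nat.zero_testBit j, ih⟩
  obtain ⟨R₃, L, rest, h, hR₃, hL, hr⟩ := exists_of_branch hJ (fun a => d a.code ≤ D₂) h
    (hvalid _) hcount hR₂
  have hmap : ∀ l : List Item, (l.map fun a => (a, 0, 0)).map (Prod.fst (β := ℕ × ℕ)) = l := by
    intro l
    rw [List.map_map]
    exact List.map_id l
  rw [hmap] at hL hr
  have hmem : ∀ a, (a ∈ triples.filter fun a => isLow a₁.code a) ↔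
      a ∈ triples ∧ isLow a₁.code a = true := fun a => List.mem_filter
  have hmem' : ∀ a, (a ∈ triples.filter fun a => !isLow a₁.code a) ↔
      a ∈ triples ∧ ¬ isLow a₁.code a = true := fun a => by
    rw [List.mem_filter]; simp
  replace hL : ∀ a, a ∈ L ↔ a ∈ triples ∧ d a.code ≤ D₂ := fun a => by
    rw [hL, hL₁, hmem, hmem', List.mem_nil_iff]
    tauto
  obtain ⟨R₄, B, rest', h, hR₄, hB, hr'⟩ := exists_of_level_eq hJ
    (triples.filter fun a => !isLow a₁.code a) (D₂ + 1) h hsegs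
    (fun a ha => htriples a ((hmem' a).1 ha).1)
    (fun a => by rw [hr, List.mem_nil_iff, false_or]; exact and_congr_right fun _ => by omega)
    (fun b hb => ⟨(htriples b ((hL b).1 hb).1).code_ne_zero, by
      have := ((hL b).1 hb).2; omega⟩)
    (fun u hu hu' => hhigh u hu (by omega))
    (by
      obtain ⟨a, ha, hd⟩ := hlev₃ (D₂ + 1) (by omega) htop
      refine ⟨a, ?_⟩
      rw [hM, hmem, hmem']
      have : ¬ d a.code ≤ D₂ := by omega
      tauto) hR₃
  obtain ⟨R', tops, segs', h, hR', hsegs', htops⟩ := exists_of_placeTriples hJ htriples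
    (v := D₂ + 1) h (fun t ht h1 h2 => hstep t ht h1 (by omega))
    (fun u hu hu' => hlev₃ u (by omega) (by omega))
    (fun a => by
      rw [hB, hM, hmem, hmem', List.mem_nil_iff, false_or]
      have : a ∈ triples → isLow a₁.code a = true → ¬ d a.code ≤ D₂ → d a.code = D₂ + 1 :=
        fun h1 h2 h3 => by have := hlow a h1 h2; omega
      have : d a.code = D₂ + 1 → ¬ d a.code ≤ D₂ := by omega
      tauto)
    (fun a => by
      rw [hr', hmem']
      have : a ∈ triples → isLow a₁.code a = true → ¬ D₂ + 1 + 1 ≤ d a.code :=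
        fun h1 h2 => by have := hlow a h1 h2; omega
      tauto) hsegs hR₄
  rw [finishPairs_eq_false hJ hD₂ hpairs htriples hsegs'
    (fun u hu hu' => hlev₂ u (by omega) hu') (fun a ha => (hB₁ a).1 ha)
    (fun a ha => (hB₂ a).1 ha) hr₂ (fun a ha hd => (hL a).2 ⟨ha, hd⟩)
    (fun a ha hd => (htops a).2 ⟨ha, by omega⟩) hmerge hR'] at h
  exact Bool.false_ne_true h
/-! ### Connection with sets of states -/

/-- The set coded by `c`. -/
noncomputable def decode (c : ℕ) : Finset (Fin 5) := Finset.univ.filter fun i => c.testBit i = true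

theorem mem_decode {c : ℕ} {i : Fin 5} : i ∈ decode c ↔ c.testBit i = true := by simp [decode]

noncomputable def tripleCodes : List ℕ := tripleTable.map tripleCode

theorem exists_pairCode : ∀ X : Finset (Fin 5), X.card = 2 → ∃ a ∈ pairCodes, decode a = X := by
  decide +kernel

theorem exists_tripleCode :
    ∀ X : Finset (Fin 5), X.card = 3 → ∃ a ∈ tripleCodes, decode a = X := by
  decide +kernel

theorem card_decode_pairCode : ∀ a ∈ pairCodes, a < 32 ∧ (decode a).card = 2 := by decide +kernel

theorem card_decode_tripleCode : ∀ a ∈ tripleCodes, a < 32 ∧ (decode a).card = 3 := by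
  decide +kernel

theorem mem_tripleCodes : ∀ a < 32, (decode a).card = 3 → a ∈ tripleCodes := by decide +kernel

theorem mergedCode_mem : ∀ c ∈ mergeTable, mergedCode c ∈ pairCodes := by decide +kernel

theorem testBit_imageCode (w : List ℕ) (a i : ℕ) :
    (imageCode w a).testBit i = true ↔ ∃ x : ℕ, w[x]? = some i ∧ a.testBit x = true := by
  induction w generalizing a with
  | nil => simp [imageCode]
  | cons j w ih =>
    have hsplit : (∃ x, (j :: w)[x]? = some i ∧ a.testBit x = true) ↔
        (j = i ∧ a.testBit 0 = true) ∨
          ∃ x : ℕ, w[x]? = some i ∧ (Nat.shiftRight a 1).testBit x = true := by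
      constructor
      · rintro ⟨x, hx, ha⟩
        cases x with
        | zero => exact Or.inl ⟨by simpa using hx, ha⟩
        | succ x => exact Or.inr ⟨x, by simpa using hx, by rwa [testBit_shiftRight', add_comm]⟩
      · rintro (⟨rfl, ha⟩ | ⟨x, hx, ha⟩)
        · exact ⟨0, rfl, ha⟩
        · exact ⟨x + 1, by simpa using hx, by rwa [testBit_shiftRight', add_comm] at ha⟩
    rw [imageCode, hsplit, ← ih, beq_eq_decide]
    have h0 : Nat.land a 1 = 0 ↔ ¬ a.testBit 0 = true := by
      change a &&& 1 = 0 ↔ _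
      rw [Nat.and_one_is_mod, Nat.testBit_zero]
      simp
    by_cases h : a.testBit 0 = true
    · rw [decide_eq_false (by tauto), cond_false, testBit_lor, testBit_shiftOne, Bool.or_eq_true,
        decide_eq_true_iff, eq_comm]
      tauto
    · rw [decide_eq_true (by tauto), cond_true]
      tauto

/-- The word `w` describes the restriction of `g` to `S`. -/
structure Describes (w : List ℕ) (g : Fin 5 → Fin 5) (S : Finset (Fin 5)) : Prop where
  length_eq : w.length = 5
  lt_five : ∀ i ∈ w, i < 5
  getElem?_eq : ∀ i ∈ S, w[(i : ℕ)]? = some (g i : ℕ)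

theorem Describes.decode_imageCode {w : List ℕ} {g : Fin 5 → Fin 5} {S : Finset (Fin 5)}
    (h : Describes w g S) {a : ℕ} (ha : decode a ⊆ S) :
    decode (imageCode w a) = (decode a).image g := by
  ext j
  rw [mem_decode, testBit_imageCode, Finset.mem_image]
  constructor
  · rintro ⟨x, hx, hax⟩
    obtain ⟨hx5, -⟩ := List.getElem?_eq_some_iff.1 hx
    rw [h.length_eq] at hx5
    have hmem : (⟨x, hx5⟩ : Fin 5) ∈ decode a := mem_decode.2 hax
    refine ⟨_, hmem, ?_⟩
    have := h.getElem?_eq _ (ha hmem)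
    rw [hx, Option.some_inj] at this
    exact Fin.ext this.symm
  · rintro ⟨i, hi, rfl⟩
    exact ⟨i, h.getElem?_eq i (ha hi), mem_decode.1 hi⟩

theorem imageCode_lt {w : List ℕ} (h : ∀ i ∈ w, i < 5) (a : ℕ) : imageCode w a < 32 := by
  refine Nat.lt_pow_two_of_testBit (n := 5) _ fun i hi => ?_
  rw [Bool.eq_false_iff, ne_eq, testBit_imageCode]
  rintro ⟨x, hx, -⟩
  have := h i (List.mem_of_getElem? hx)
  omega

theorem mem_injectiveWords {k : ℕ} {l : List ℕ} (hl : l.length = k) (hd : l.Nodup)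
    (h5 : ∀ i ∈ l, i < 5) : l ∈ injectiveWords k := by
  induction k generalizing l with
  | zero => rw [List.length_eq_zero_iff.1 hl]; simp [injectiveWords]
  | succ k ih =>
    cases l with
    | nil => simp at hl
    | cons a l =>
      rw [injectiveWords, List.mem_flatMap]
      rw [List.nodup_cons] at hd
      refine ⟨l, ih (by simpa using hl) hd.2 fun i hi => h5 i (List.mem_cons_of_mem a hi), ?_⟩
      have ha := h5 a List.mem_cons_self
      rw [List.mem_map]
      refine ⟨a, ?_, rfl⟩
      rw [List.mem_filter]
      refine ⟨?_, by simpa using hd.1⟩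
      interval_cases a <;> simp

theorem exists_shiftWord {g : Fin 5 → Fin 5} (i : Fin 4)
    (hg : (Finset.univ.erase i.succ).image g = Finset.univ.erase i.castSucc) :
    ∃ w ∈ shiftWords i, Describes w g (Finset.univ.erase i.succ) := by
  set g' : Fin 5 → Fin 5 := Function.update g i.succ i.castSucc with hg'
  have hsurj : Function.Surjective g' := by
    intro j
    by_cases hj : j = i.castSucc
    · exact ⟨i.succ, by rw [hg', Function.update_self, hj]⟩
    · have : j ∈ (Finset.univ.erase i.succ).image g := by simp [hg, hj]
      obtain ⟨k, hk, rfl⟩ := Finset.mem_image.1 this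
      exact ⟨k, by rw [hg', Function.update_of_ne (Finset.ne_of_mem_erase hk)]⟩
  have hinj : Function.Injective g' := Finite.injective_iff_surjective.2 hsurj
  have hget : ∀ k : Fin 5, (List.ofFn fun k => (g' k : ℕ))[(k : ℕ)]? = some (g' k : ℕ) := by
    intro k
    rw [List.getElem?_ofFn, dif_pos k.2]
  have h5 : ∀ k ∈ List.ofFn fun k => (g' k : ℕ), k < 5 := by
    intro k hk
    obtain ⟨x, rfl⟩ := (List.mem_ofFn' _ _).1 hk
    exact (g' x).2
  refine ⟨List.ofFn fun k => (g' k : ℕ), ?_, by simp, h5, ?_⟩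
  · rw [shiftWords, List.mem_filter]
    refine ⟨mem_injectiveWords (by simp) ?_ h5, ?_⟩
    · exact List.nodup_ofFn.2 (Fin.val_injective.comp hinj)
    · rw [beq_eq_decide, decide_eq_true_iff, List.getD_eq_getElem?_getD]
      have := hget i.succ
      rw [Fin.val_succ] at this
      rw [this, hg', Function.update_self]
      rfl
  · intro k hk
    rw [hget, hg', Function.update_of_ne (Finset.ne_of_mem_erase hk)]

theorem exists_wordOfThree {g : Fin 5 → Fin 5} {S : Finset (Fin 5)} (a x y : Fin 5)
    (ha : ∀ i ∈ S, i ≠ x → i ≠ y → g i = a) (hcard : (S.image g).card = 3) :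
    ∃ w ∈ wordsOfThree x y, Describes w g S := by
  have hsub : S.image g ⊆ {a, g x, g y} := by
    intro j hj
    obtain ⟨i, hi, rfl⟩ := Finset.mem_image.1 hj
    by_cases hx : i = x
    · simp [hx]
    · by_cases hy : i = y
      · simp [hy]
      · simp [ha i hi hx hy]
  have hle := Finset.card_le_card hsub
  rw [hcard] at hle
  have hab : a ≠ g x := by
    intro h
    have := Finset.card_le_two (a := g x) (b := g y)
    simp [h] at hle
    omega
  have hac : a ≠ g y := by
    intro h
    have := Finset.card_le_two (a := g x) (b := g y)
    rw [h, Finset.insert_eq_of_mem (by simp)] at hle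
    omega
  have hbc : g x ≠ g y := by
    intro h
    have := Finset.card_le_two (a := a) (b := g y)
    rw [h, Finset.pair_eq_singleton] at hle
    omega
  have hmem : ∀ i : Fin 5, (i : ℕ) < 5 := fun i => i.2
  refine ⟨wordOfThree x y a (g x) (g y), ?_, rfl, ?_, ?_⟩
  · rw [wordsOfThree, List.mem_map]
    refine ⟨[(a : ℕ), g x, g y], mem_injectiveWords rfl ?_ ?_, rfl⟩
    · simp [hab, hac, hbc, Fin.val_inj]
    · simp
  · intro i hi
    rw [wordOfThree, List.mem_map] at hi
    obtain ⟨k, -, rfl⟩ := hi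
    rw [beq_eq_decide, beq_eq_decide]
    cases decide (k = x) <;> cases decide (k = y) <;> exact hmem _
  · intro i hi
    have hget : (wordOfThree x y a (g x) (g y))[(i : ℕ)]? = some
        (bif Nat.beq i x then (g x : ℕ) else bif Nat.beq i y then (g y : ℕ) else a) := by
      fin_cases i <;> rfl
    rw [hget, beq_eq_decide, beq_eq_decide]
    by_cases hx : i = x
    · simp [hx]
    · by_cases hy : i = y
      · subst hy
        simp [Fin.val_inj, hx]
      · simp [Fin.val_inj, hx, hy, ha i hi hx hy]

theorem length_letters : letters.length = 1056 := by decide +kernel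

theorem mem_letters {k s : ℕ} {ws : List (List ℕ)} (h : (k, s, ws) ∈ groups) {w : List ℕ}
    (hw : w ∈ ws) : ⟨k, s, w, imageCode w s⟩ ∈ letters :=
  List.mem_flatMap.2 ⟨(k, s, ws), h, List.mem_map.2 ⟨w, hw, rfl⟩⟩

section Contradiction

variable (D : Finset (Fin 5) → ℕ) (pq top : ℕ)

/-- The conditions on the letters that the search may use. -/
structure IsGood (ℓ : Letter) : Prop where
  le_succ : ∀ a, (decode a).Nonempty → Nat.land a ℓ.source = a →
    D (decode a) ≤ D (decode (imageCode ℓ.word a)) + 1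
  target_triple : ℓ.key ∈ tripleCodes →
    ℓ.target ∈ tripleCodes ∧ D (decode ℓ.target) + 1 = D (decode ℓ.key)
  target_merge : ℓ.key = pq → ℓ.target ∈ tripleCodes ∧ D (decode ℓ.target) = top

def goodPositions : Set ℕ :=
  {j | ∃ x ℓ, letters[x]? = some ℓ ∧ j = offset + x ∧ IsGood D pq top ℓ}

variable {D pq top}

theorem exists_position {ℓ : Letter} (hmem : ℓ ∈ letters) (hg : IsGood D pq top ℓ) :
    ∃ j ∈ goodPositions D pq top, (segment ℓ.key letters offset).testBit j = true := by
  obtain ⟨x, hx⟩ := List.getElem?_of_mem hmem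
  exact ⟨offset + x, ⟨x, ℓ, hx, rfl, hg⟩, (testBit_segment _ _ _ _).2 ⟨x, ℓ, hx, rfl, rfl⟩⟩

theorem itemOf_row (ls : List Letter) (a : ℕ) : (itemOf ls a).row = rowOf a ls offset a := rfl

theorem exists_good_of_segment {j key : ℕ} (hj : j ∈ goodPositions D pq top)
    (hs : (segment key letters offset).testBit j = true) :
    ∃ ℓ : Letter, ℓ.key = key ∧ IsGood D pq top ℓ ∧
      (itemOf letters ℓ.target).row.testBit j = true := by
  obtain ⟨x, ℓ, hx, rfl, hg⟩ := hj
  obtain ⟨x', ℓ', hx', hkey, he⟩ := (testBit_segment _ _ _ _).1 hs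
  obtain rfl : x = x' := Nat.add_left_cancel he
  rw [hx, Option.some_inj] at hx'
  subst hx'
  refine ⟨ℓ, hkey, hg, ?_⟩
  rw [itemOf_row, testBit_rowOf]
  exact Or.inr ⟨x, ℓ, hx, Or.inl ⟨rfl, rfl⟩⟩

theorem isConsistent_itemOf {a : ℕ} (h32 : a < 32) (ha : (decode a).Nonempty) :
    IsConsistent (fun c => D (decode c)) (goodPositions D pq top) (itemOf letters a) where
  code_ne_zero := by
    rintro h : a = 0
    subst h
    obtain ⟨i, hi⟩ := ha
    simp [mem_decode] at hi
  le_succ := by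
    rintro _ ⟨x, ℓ, hx, rfl, hg⟩ c hc ht
    have hlt : ∀ {x ℓ}, letters[x]? = some ℓ → x < 1056 := fun {x ℓ} hx => by
      rw [← length_letters]
      exact (List.getElem?_eq_some_iff.1 hx).1
    have hx5 := hlt hx
    generalize hi : width * c + (offset + x) = i at ht
    rw [itemOf_row, testBit_rowOf] at ht
    rcases ht with ht | ⟨x', ℓ', hx', ⟨-, he⟩ | ⟨hland, he⟩⟩
    · have h5 : 5 ≤ i := by simp only [offset] at hi; omega
      have ha32 : a < 2 ^ i := by
        have := Nat.pow_le_pow_right (n := 2) (by norm_num) h5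
        omega
      rw [Nat.testBit_lt_two_pow ha32] at ht
      exact absurd ht Bool.false_ne_true
    · have := hlt hx'
      simp only [offset, width] at he hi
      omega
    · have := hlt hx'
      simp only [offset, width] at he hi
      obtain rfl : c = imageCode ℓ'.word a := by omega
      obtain rfl : x = x' := by omega
      rw [hx, Option.some_inj] at hx'
      subst hx'
      exact hg.le_succ a ha hland

theorem decode_subset_of_land {a s : ℕ} (h : Nat.land a s = a) : decode a ⊆ decode s := by
  intro i hi
  rw [mem_decode] at hi ⊢
  rw [← h, testBit_land, Bool.and_eq_true] at hi
  exact hi.2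

theorem le_succ_of_describes {w : List ℕ} {g : Fin 5 → Fin 5} {s : ℕ}
    (hw : Describes w g (decode s))
    (hg : ∀ A ⊆ decode s, A.Nonempty → D A ≤ D (A.image g) + 1) (a : ℕ)
    (ha : (decode a).Nonempty) (h : Nat.land a s = a) :
    D (decode a) ≤ D (decode (imageCode w a)) + 1 := by
  have hsub := decode_subset_of_land h
  rw [hw.decode_imageCode hsub]
  exact hg _ hsub ha

theorem mem_groups_shift : ∀ i : Fin 4, (31 - 2 ^ ((i : ℕ) + 1), 31 - 2 ^ ((i : ℕ) + 1),
    shiftWords i) ∈ groups := by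
  intro i
  rw [groups, List.mem_append, List.mem_append]
  refine Or.inl (Or.inl (List.mem_map.2 ⟨i, ?_, rfl⟩))
  fin_cases i <;> simp

theorem mem_groups_triple {t : ℕ × ℕ × ℕ} (h : t ∈ tripleTable) :
    (tripleCode t, tripleCode t, wordsOfThree t.2.1 t.2.2) ∈ groups := by
  rw [groups, List.mem_append, List.mem_append]
  exact Or.inl (Or.inr (List.mem_map.2 ⟨t, h, rfl⟩))

theorem mem_groups_merge {c : ℕ × ℕ} (h : c ∈ mergeTable) :
    (mergedCode c, 30, wordsOfThree c.1 c.2) ∈ groups := by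
  rw [groups, List.mem_append]
  exact Or.inr (List.mem_map.2 ⟨c, h, rfl⟩)

theorem decode_shift : ∀ i : Fin 4, decode (31 - 2 ^ ((i : ℕ) + 1)) = Finset.univ.erase i.succ ∧
    31 - 2 ^ ((i : ℕ) + 1) ∉ tripleCodes ∧
    ∀ c ∈ mergeTable, 31 - 2 ^ ((i : ℕ) + 1) ≠ mergedCode c := by
  decide +kernel

theorem decode_triple : ∀ t ∈ tripleTable, (∃ p q r : Fin 5, t.2.1 = q ∧ t.2.2 = r ∧
    decode (tripleCode t) = {p, q, r}) ∧ ∀ c ∈ mergeTable, tripleCode t ≠ mergedCode c := by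
  decide +kernel

theorem decode_merge : ∀ c ∈ mergeTable, mergedCode c ∉ tripleCodes ∧
    ∃ x y : Fin 5, c.1 = x ∧ c.2 = y ∧ decode (mergedCode c) = (decode 30 \ {x, y}) := by
  decide +kernel

theorem isLow_spec : ∀ c ∈ mergeTable, ∀ t ∈ tripleCodes,
    Nat.land t (mergedCode c) = mergedCode c → Nat.land t 1 = 0 →
      decode (mergedCode c) ⊆ decode t ∧ 0 ∉ decode t := by
  decide +kernel

theorem length_filter_isLow : ∀ c ∈ mergeTable, (tripleCodes.filter fun t =>
    !(Nat.beq (Nat.land t (mergedCode c)) (mergedCode c) && Nat.beq (Nat.land t 1) 0)).length ≤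
      8 := by
  decide +kernel

theorem not_searchAll {c : ℕ × ℕ} (hc : c ∈ mergeTable) {D₂ : ℕ}
    (hv : (D₂, top) ∈ [(10, 19), (9, 18), (10, 18)])
    (hpos : ∀ X : Finset (Fin 5), X.card = 2 → 1 ≤ D X)
    (hlev₂ : ∀ u, 1 ≤ u → u ≤ D₂ → ∃ X : Finset (Fin 5), X.card = 2 ∧ D X = u)
    (hlev₃ : ∀ u, D₂ < u → u ≤ top → ∃ X : Finset (Fin 5), X.card = 3 ∧ D X = u)
    (hone : D (decode (mergedCode c)) = 1)
    (hlow : ∀ X : Finset (Fin 5), X.card = 3 → decode (mergedCode c) ⊆ X → 0 ∉ X →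
      D X ≤ D₂ + 1)
    (hshift : ∀ i : Fin 4, (i : ℕ) < 22 - top →
      IsStep D (Finset.univ.erase i.succ) (Finset.univ.erase i.castSucc))
    (hstep : ∀ X : Finset (Fin 5), X.card = 3 → D₂ + 1 < D X → D X ≤ top →
      ∃ Y : Finset (Fin 5), Y.card = 3 ∧ IsStep D X Y ∧ D Y + 1 = D X)
    (hmerge : ∃ g : Fin 5 → Fin 5, (∀ A ⊆ decode 30, A.Nonempty → D A ≤ D (A.image g) + 1) ∧
      ((decode (mergedCode c)).image g).card = 1 ∧ ((decode 30).image g).card = 3 ∧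
      D ((decode 30).image g) = top) :
    searchAll = false := by
  rw [Bool.eq_false_iff]
  intro h
  rw [searchAll, forceLetters_eq, buildItems_eq, buildItems_eq] at h
  replace h := List.all_eq_true.1 (List.all_eq_true.1 h c hc) _ hv
  rw [searchCase, force_eq, force_eq, forceList_eq, force_eq] at h
  have hbounds : 2 ≤ D₂ ∧ D₂ < top ∧ 22 - top ≤ 4 := by
    simp only [List.mem_cons, Prod.mk.injEq, List.not_mem_nil, or_false] at hv
    omega
  have hJ : ∀ j ∈ goodPositions D (mergedCode c) top, offset ≤ j := by
    rintro _ ⟨x, ℓ, -, rfl, -⟩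
    exact Nat.le_add_right _ _
  refine Bool.false_ne_true ((search_eq_false (d := fun c => D (decode c))
    (J := goodPositions D (mergedCode c) top) hJ hbounds.1 hbounds.2.1
    ?_ ?_ ?_ ?_ ?_ ?_ ?_ ?_ ?_ ?_ ?_ ?_).symm.trans h)
  · intro a ha
    obtain ⟨t, ht, rfl⟩ := List.mem_map.1 ha
    obtain ⟨h1, h2⟩ := card_decode_pairCode t ht
    exact isConsistent_itemOf h1 (Finset.card_pos.1 (by omega))
  · intro a ha
    obtain ⟨t, ht, rfl⟩ := List.mem_map.1 ha
    obtain ⟨h1, h2⟩ := card_decode_tripleCode t ht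
    exact isConsistent_itemOf h1 (Finset.card_pos.1 (by omega))
  · intro s hs
    rcases List.mem_cons.1 hs with rfl | hs
    · obtain ⟨g, hg, hg1, hg3, hgD⟩ := hmerge
      obtain ⟨hnot, x, y, hx, hy, hdec⟩ := decode_merge c hc
      obtain ⟨a, ha⟩ := Finset.card_eq_one.1 hg1
      obtain ⟨w, hw, hdesc⟩ := exists_wordOfThree (S := decode 30) (g := g) a x y
        (fun i hi hix hiy => by
          have : g i ∈ (decode (mergedCode c)).image g :=
            Finset.mem_image_of_mem g (by rw [hdec]; simp [hi, hix, hiy])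
          rw [ha] at this
          simpa using this) hg3
      rw [← hx, ← hy] at hw
      refine exists_position (mem_letters (mem_groups_merge hc) hw)
        ⟨le_succ_of_describes hdesc hg, fun h => absurd h hnot, fun _ => ?_⟩
      rw [hdesc.decode_imageCode subset_rfl]
      refine ⟨mem_tripleCodes _ (imageCode_lt hdesc.lt_five _) ?_, hgD⟩
      rw [hdesc.decode_imageCode subset_rfl, hg3]
    · obtain ⟨i, hi, rfl⟩ := List.mem_map.1 hs
      rw [List.mem_range] at hi
      have hi4 : i < 4 := by omega
      obtain ⟨g, hgi, hg⟩ := hshift ⟨i, hi4⟩ hi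
      obtain ⟨hdec, hnot, hne⟩ := decode_shift ⟨i, hi4⟩
      obtain ⟨w, hw, hdesc⟩ := exists_shiftWord ⟨i, hi4⟩ hgi
      rw [← hdec] at hdesc hg
      exact exists_position (mem_letters (mem_groups_shift ⟨i, hi4⟩) hw)
        ⟨le_succ_of_describes hdesc hg, fun h => absurd h hnot, fun h => absurd h (hne c hc)⟩
  · rintro _ ⟨x, ℓ, hx, rfl, -⟩
    have := (List.getElem?_eq_some_iff.1 hx).1
    rw [length_letters] at this
    rw [Nat.testBit_two_pow_sub_one, decide_eq_true_iff]
    simp only [offset, width]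
    omega
  · intro a ha
    obtain ⟨t, ht, rfl⟩ := List.mem_map.1 ha
    exact hpos _ (card_decode_pairCode t ht).2
  · exact ⟨_, List.mem_map.2 ⟨_, mergedCode_mem c hc, rfl⟩, rfl, hone⟩
  · intro u h1 h2
    obtain ⟨X, hX, hu⟩ := hlev₂ u h1 h2
    obtain ⟨a, ha, rfl⟩ := exists_pairCode X hX
    exact ⟨_, List.mem_map.2 ⟨a, ha, rfl⟩, hu⟩
  · intro u h1 h2
    obtain ⟨X, hX, hu⟩ := hlev₃ u h1 h2
    obtain ⟨a, ha, rfl⟩ := exists_tripleCode X hX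
    exact ⟨_, List.mem_map.2 ⟨a, ha, rfl⟩, hu⟩
  · intro a ha hl
    obtain ⟨t, ht, rfl⟩ := List.mem_map.1 ha
    rw [isLow, Bool.and_eq_true, beq_eq_decide, beq_eq_decide, decide_eq_true_iff,
      decide_eq_true_iff] at hl
    obtain ⟨h1, h2⟩ := isLow_spec c hc t ht hl.1 hl.2
    exact hlow _ (card_decode_tripleCode t ht).2 h1 h2
  · rw [List.filter_map, List.length_map]
    exact length_filter_isLow c hc
  · intro a ha h1 h2
    obtain ⟨t, ht, rfl⟩ := List.mem_map.1 ha
    refine ⟨?_, fun j hj hs => ?_⟩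
    · obtain ⟨Y, hY, ⟨g, rfl, hg⟩, hD⟩ := hstep _ (card_decode_tripleCode t ht).2 h1 h2
      obtain ⟨t, ht', rfl⟩ := List.mem_map.1 ht
      obtain ⟨⟨p, q, r, hq, hr, hdec⟩, hne⟩ := decode_triple t ht'
      obtain ⟨w, hw, hdesc⟩ := exists_wordOfThree (S := decode (tripleCode t)) (g := g) (g p) q r
        (fun i hi hiq hir => by
          rw [hdec] at hi
          simp only [Finset.mem_insert, Finset.mem_singleton] at hi
          rw [show i = p by tauto]) hY
      rw [← hq, ← hr] at hw
      refine exists_position (mem_letters (mem_groups_triple ht') hw)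
        ⟨le_succ_of_describes hdesc hg, fun _ => ?_, fun h => absurd h (hne c hc)⟩
      rw [hdesc.decode_imageCode subset_rfl]
      refine ⟨mem_tripleCodes _ (imageCode_lt hdesc.lt_five _) ?_, hD⟩
      rw [hdesc.decode_imageCode subset_rfl, hY]
    · obtain ⟨ℓ, hkey, hgood, hrow⟩ := exists_good_of_segment hj hs
      obtain ⟨h3, h4⟩ := hgood.target_triple (hkey ▸ ht)
      exact ⟨_, List.mem_map.2 ⟨_, h3, rfl⟩, hrow, h4.trans (by rw [hkey]; rfl)⟩
  · intro j hj hs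
    obtain ⟨ℓ, hkey, hgood, hrow⟩ := exists_good_of_segment hj hs
    obtain ⟨h3, h4⟩ := hgood.target_merge hkey
    exact ⟨_, List.mem_map.2 ⟨_, h3, rfl⟩, hrow, h4⟩

end Contradiction

theorem searchAll_eq_true : searchAll = true := by decide +kernel

end SyncSearch

section Quadruples

open SyncSearch

theorem decode_thirty : decode 30 = Finset.univ.erase 0 := by decide +kernel

theorem exists_mergedCode : ∀ p q : Fin 5, p ≠ q → p ≠ 0 → q ≠ 0 →
    ∃ c ∈ mergeTable, decode (mergedCode c) = {p, q} := by
  decide +kernel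

theorem card_triples_not_low : ∀ p q : Fin 5, p ≠ q → p ≠ 0 → q ≠ 0 →
    (Finset.univ.filter fun X : Finset (Fin 5) =>
      X.card = 3 ∧ ¬ (p ∈ X ∧ q ∈ X ∧ 0 ∉ X)).card = 8 := by
  decide +kernel

theorem exists_notMem_of_card_two : ∀ X : Finset (Fin 5), X.card = 2 →
    ∃ i : Fin 5, (i : ℕ) < 3 ∧ i ∉ X := by
  decide +kernel

theorem exists_erase_of_card_four : ∀ X : Finset (Fin 5), X.card = 4 →
    ∃ i : Fin 5, X = Finset.univ.erase i := by
  decide +kernel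

namespace IsSyncRank

variable {B : ℕ} {D : Finset (Fin 5) → ℕ}

theorem isStep_image {n : ℕ} {D : Finset (Fin n) → ℕ} (σ : Equiv.Perm (Fin n))
    {X Y : Finset (Fin n)} (h : IsStep D (X.image σ) (Y.image σ)) :
    IsStep (fun Z => D (Z.image σ)) X Y := by
  obtain ⟨g, hg, hle⟩ := h
  have himage : ∀ A : Finset (Fin n), (A.image (σ.symm ∘ g ∘ σ)).image σ =
      (A.image σ).image g := fun A => by
    simp only [Finset.image_image, Function.comp_def, Equiv.apply_symm_apply]
  refine ⟨σ.symm ∘ g ∘ σ, ?_, fun A hA hne => ?_⟩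
  · exact Finset.image_injective σ.injective ((himage X).trans hg)
  · beta_reduce
    rw [himage]
    exact hle _ (Finset.image_subset_image hA) (hne.image σ)

theorem comp_image {n : ℕ} {D : Finset (Fin n) → ℕ} (hD : IsSyncRank B D)
    (σ : Equiv.Perm (Fin n)) : IsSyncRank B fun X => D (X.image σ) where
  eq_zero_iff X hX := by
    rw [hD.eq_zero_iff _ (hX.image σ), Finset.card_image_of_injective X σ.injective]
  le_bound X := hD.le_bound _
  exists_step X hX hlt := by
    rw [← Finset.card_image_of_injective X σ.injective] at hX
    obtain ⟨Y, hY, hDY⟩ := hD.exists_step _ hX hlt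
    have himage : (Y.image σ.symm).image σ = Y := by
      simp only [Finset.image_image, Function.comp_def, Equiv.apply_symm_apply, Finset.image_id']
    exact ⟨Y.image σ.symm, isStep_image σ (himage.symm ▸ hY), by rwa [himage]⟩

theorem exists_chain {n : ℕ} {D : Finset (Fin n) → ℕ} (hD : IsSyncRank B D) {X : Finset (Fin n)}
    (hX : X.Nonempty) (hlt : D X < B) : ∃ Z : ℕ → Finset (Fin n), Z 0 = X ∧
      ∀ j ≤ D X, (Z j).Nonempty ∧ D (Z j) + j = D X ∧
        (j < D X → IsStep D (Z j) (Z (j + 1))) := by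
  have hnext : ∀ Y : Finset (Fin n), ∃ Y', 1 < Y.card → D Y < B →
      IsStep D Y Y' ∧ D Y' + 1 = D Y := by
    intro Y
    by_cases h : 1 < Y.card ∧ D Y < B
    · obtain ⟨Y', hY'⟩ := hD.exists_step Y h.1 h.2
      exact ⟨Y', fun _ _ => hY'⟩
    · exact ⟨Y, fun h₁ h₂ => absurd ⟨h₁, h₂⟩ h⟩
  choose next hnext using hnext
  have hstep : ∀ j < D X, (next^[j] X).Nonempty → D (next^[j] X) + j = D X →
      IsStep D (next^[j] X) (next^[j + 1] X) ∧ D (next^[j + 1] X) + 1 = D (next^[j] X) := by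
    intro j hj hne hDj
    rw [Function.iterate_succ_apply']
    exact hnext _ (hD.one_lt_card hne (by omega)) (by omega)
  have hmain : ∀ j ≤ D X, (next^[j] X).Nonempty ∧ D (next^[j] X) + j = D X := by
    intro j
    induction j with
    | zero => exact fun _ => ⟨hX, rfl⟩
    | succ j ih =>
      intro hj
      obtain ⟨hne, hDj⟩ := ih (by omega)
      obtain ⟨h₁, h₂⟩ := hstep j hj hne hDj
      exact ⟨nonempty_of_isStep h₁ hne, by omega⟩
  exact ⟨fun j => next^[j] X, rfl, fun j hj => ⟨(hmain j hj).1, (hmain j hj).2, fun hj' =>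
    (hstep j hj' (hmain j hj).1 (hmain j hj).2).1⟩⟩

/-- After renaming the states, the sets of four states met by a shortest word from a set of rank
`23` miss the states `N - 1, …, 0`, in this order. -/
theorem exists_renaming (hD : IsSyncRank B D) {S : Finset (Fin 5)} (hS : S.card = 4)
    (hlt : D S < B) (h23 : 23 ≤ D S) :
    ∃ (D' : Finset (Fin 5) → ℕ) (N : ℕ), IsSyncRank B D' ∧ 3 ≤ N ∧ N ≤ 5 ∧
      (∀ i : Fin 5, (i : ℕ) < N → D' (Finset.univ.erase i) < B) ∧
      (∀ i : Fin 4, (i : ℕ) + 1 < N →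
        IsStep D' (Finset.univ.erase i.succ) (Finset.univ.erase i.castSucc)) ∧
      ∃ Y : Finset (Fin 5), Y.card < 4 ∧ IsStep D' (Finset.univ.erase 0) Y ∧ D' Y < B ∧
        D' Y + N = 23 := by
  obtain ⟨X, hX, hX4, hDX⟩ := hD.exists_level (Finset.card_pos.1 (by omega)) hlt h23
  obtain ⟨Z, rfl, hZ⟩ := hD.exists_chain hX (by omega)
  rw [hDX] at hZ
  have hex : ∃ j, (Z j).card < 4 := by
    obtain ⟨hne, hD0, -⟩ := hZ 23 le_rfl
    have := (hD.eq_zero_iff _ hne).1 (by omega)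
    exact ⟨23, by omega⟩
  set N := Nat.find hex with hN
  have hN4 : (Z N).card < 4 := Nat.find_spec hex
  have hN23 : N ≤ 23 := by
    obtain ⟨hne, hD0, -⟩ := hZ 23 le_rfl
    have := (hD.eq_zero_iff _ hne).1 (by omega)
    exact Nat.find_min' hex (by omega)
  have hcard : ∀ j < N, (Z j).card = 4 := by
    intro j hj
    have hge : 4 ≤ (Z j).card := not_lt.1 (Nat.find_min hex hj)
    refine le_antisymm ?_ hge
    clear hge
    induction j with
    | zero => omega
    | succ j ih =>
      exact (card_le_of_isStep ((hZ j (by omega)).2.2 (by omega))).trans (ih (by omega))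
  have hZN := hZ N hN23
  have hN3 : 3 ≤ N := by
    have := hD.le_twenty_of_triple hZN.1 (Nat.lt_succ_iff.1 hN4) (by omega)
    omega
  have hmissing : ∀ j, ∃ i : Fin 5, j < N → Z j = Finset.univ.erase i := by
    intro j
    by_cases hj : j < N
    · obtain ⟨i, hi⟩ := exists_erase_of_card_four (Z j) (hcard j hj)
      exact ⟨i, fun _ => hi⟩
    · exact ⟨0, fun h => absurd h hj⟩
  choose μ hμ using hmissing
  have hinj : ∀ j < N, ∀ j' < N, μ j = μ j' → j = j' := by
    intro j hj j' hj' h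
    have h₁ := (hZ j (by omega)).2.1
    have h₂ := (hZ j' (by omega)).2.1
    rw [hμ j hj, h, ← hμ j' hj'] at h₁
    omega
  have hN5 : N ≤ 5 := by
    have := Finset.card_le_card_of_injOn (s := Finset.range N) (t := Finset.univ) μ
      (fun _ _ => Finset.mem_univ _)
      (fun j hj j' hj' h => hinj j (by simpa using hj) j' (by simpa using hj') h)
    simpa using this
  obtain ⟨e, he⟩ := Finset.exists_equiv_extend_of_card_eq (t := (Finset.univ : Finset (Fin 5)))
    (by simp) (s := Finset.univ.filter fun i : Fin 5 => (i : ℕ) < N)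
    (f := fun i => μ (N - 1 - i)) (Finset.subset_univ _) (by
      intro i hi i' hi' h
      simp only [Finset.mem_coe, Finset.mem_filter, Finset.mem_univ, true_and] at hi hi'
      have := hinj _ (by omega) _ (by omega) h
      exact Fin.ext (by omega))
  set σ : Equiv.Perm (Fin 5) := e.trans (Equiv.subtypeUnivEquiv fun x => Finset.mem_univ x) with hσ
  have hσμ : ∀ i : Fin 5, (i : ℕ) < N → σ i = μ (N - 1 - i) := fun i hi => he i (by simp [hi])
  have himage : ∀ i : Fin 5, (i : ℕ) < N → (Finset.univ.erase i).image σ = Z (N - 1 - i) := by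
    intro i hi
    rw [Finset.image_erase σ.injective, Finset.image_univ_equiv, hσμ i hi, ← hμ _ (by omega)]
  have himageN : ((Z N).image σ.symm).image σ = Z N := by
    simp only [Finset.image_image, Function.comp_def, Equiv.apply_symm_apply, Finset.image_id']
  refine ⟨fun X => D (X.image σ), N, hD.comp_image σ, hN3, hN5, fun i hi => ?_, fun i hi => ?_,
    (Z N).image σ.symm, Finset.card_image_le.trans_lt hN4, isStep_image σ ?_, ?_, ?_⟩
  · beta_reduce
    rw [himage i hi]
    have := (hZ (N - 1 - i) (by omega)).2.1
    omega
  · refine isStep_image σ ?_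
    rw [himage _ (by simpa using hi), himage _ (by rw [Fin.val_castSucc]; omega)]
    have := (hZ (N - 1 - i.succ) (by omega)).2.2 (by omega)
    rwa [show N - 1 - (i.succ : ℕ) + 1 = N - 1 - (i.castSucc : ℕ) by
      rw [Fin.val_succ, Fin.val_castSucc]; omega] at this
  · rw [himage 0 (by rw [Fin.val_zero]; omega), himageN]
    have := (hZ (N - 1) (by omega)).2.2 (by omega)
    rwa [show N - 1 + 1 = N by omega] at this
  · beta_reduce
    rw [himageN]
    omega
  · beta_reduce
    rw [himageN]
    exact hZN.2.1

theorem le_of_quadruple (hD : IsSyncRank B D) {S : Finset (Fin 5)} (hS : S.card = 4)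
    (hlt : D S < B) : D S ≤ 22 := by
  by_contra hcon
  obtain ⟨D, N, hD, hN3, hN5, hfin, hshift, Y, hY4, ⟨g, hgY, hg⟩, hYB, hDY⟩ :=
    hD.exists_renaming hS hlt (by omega)
  have hne0 : (Finset.univ.erase (0 : Fin 5)).Nonempty := ⟨1, by simp⟩
  have hinj : ¬ Set.InjOn g (Finset.univ.erase (0 : Fin 5) : Finset (Fin 5)) := fun hinj => by
    rw [← hgY, Finset.card_image_of_injOn hinj, Finset.card_erase_of_mem (Finset.mem_univ _)] at hY4
    simp at hY4
  simp only [Set.InjOn, not_forall] at hinj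
  obtain ⟨p, hp, q, hq, hpq, hne⟩ := hinj
  have hpair : ∀ X : Finset (Fin 5), X.card = 2 → D X < B := by
    intro X hX
    obtain ⟨i, hi, hiX⟩ := exists_notMem_of_card_two X hX
    refine (hD.mono (Finset.card_pos.1 (by omega)) ?_).trans_lt (hfin i (by omega))
    exact Finset.subset_erase.2 ⟨Finset.subset_univ X, hiX⟩
  obtain ⟨P, hP, hmax⟩ := Finset.exists_max_image
    (Finset.univ.filter fun X : Finset (Fin 5) => X.card = 2) D ⟨{0, 1}, by simp⟩
  simp only [Finset.mem_filter, Finset.mem_univ, true_and] at hP hmax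
  have hP10 : D P ≤ 10 := hD.le_ten_of_pair (Finset.card_pos.1 (by omega)) hP.le (hpair P hP)
  have h₂ : ∀ X : Finset (Fin 5), X.Nonempty → X.card ≤ 2 → D X < B → D X ≤ D P := by
    intro X hX hk _
    by_cases h : X.card = 2
    · exact hmax X h
    · have := hX.card_pos
      rw [(hD.eq_zero_iff X hX).2 (by omega)]
      exact Nat.zero_le _
  have hp0 := Finset.ne_of_mem_erase hp
  have hq0 := Finset.ne_of_mem_erase hq
  obtain ⟨c, hc, hdec⟩ := exists_mergedCode p q hne hp0 hq0
  have hlow : ∀ X : Finset (Fin 5), X.card = 3 → p ∈ X → q ∈ X → 0 ∉ X → D X ≤ D P + 1 :=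
    fun X hX hpX hqX h0 => hD.le_of_merge hg (hgY ▸ hYB)
      (Finset.subset_erase.2 ⟨Finset.subset_univ X, h0⟩) hpX hqX hne hpq hX.le h₂
  have hYne : Y.Nonempty := hgY ▸ hne0.image g
  have htop := hD.le_add_card_filter (k := 2) hYne hYB (Nat.lt_succ_iff.1 hY4) h₂
    (Nat.le_succ _) (fun X => ¬ (p ∈ X ∧ q ∈ X ∧ 0 ∉ X)) fun X hX _ hXF => by
      rw [not_not] at hXF
      exact hlow X hX hXF.1 hXF.2.1 hXF.2.2
  rw [card_triples_not_low p q hne hp0 hq0] at htop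
  have hcard : ∀ X : Finset (Fin 5), X.Nonempty → X.card ≤ 3 → D P < D X → D X < B →
      X.card = 3 := by
    intro X hX hk hDX hXB
    by_contra h
    have := h₂ X hX (by omega) hXB
    omega
  have hpos : ∀ X : Finset (Fin 5), X.card = 2 → 1 ≤ D X := by
    intro X hX
    have := (hD.eq_zero_iff X (Finset.card_pos.1 (by omega))).not.2 (by omega)
    omega
  refine Bool.false_ne_true ((not_searchAll (D := D) (D₂ := D P) (top := D Y) hc ?_ hpos
    ?_ ?_ ?_ ?_ ?_ ?_ ?_).symm.trans searchAll_eq_true)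
  · simp only [List.mem_cons, Prod.mk.injEq, List.not_mem_nil, or_false]
    omega
  · intro u hu1 hu
    obtain ⟨X, hX, hk, rfl⟩ := hD.exists_level (Finset.card_pos.1 (by omega)) (hpair P hP) hu
    have := hD.one_lt_card hX hu1
    exact ⟨X, by omega, rfl⟩
  · intro u hu1 hu
    obtain ⟨X, hX, hk, rfl⟩ := hD.exists_level hYne hYB hu
    exact ⟨X, hcard X hX (by omega) hu1 (by omega), rfl⟩
  · refine le_antisymm ?_ (hpos _ ?_)
    · rw [hdec]
      refine hD.le_of_merge (k := 1) (b := 0) hg (hgY ▸ hYB) ?_ (p := p) (q := q) (by simp)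
        (by simp) hne hpq (Finset.card_pair hne).le fun X hX hk _ => ?_
      · intro x hx
        rw [Finset.mem_insert, Finset.mem_singleton] at hx
        rcases hx with rfl | rfl
        exacts [hp, hq]
      · have := hX.card_pos
        exact ((hD.eq_zero_iff X hX).2 (by omega)).le
    · rw [hdec, Finset.card_pair hne]
  · intro X hX hsub h0
    rw [hdec] at hsub
    exact hlow X hX (hsub (by simp)) (hsub (by simp)) h0
  · intro i hi
    exact hshift i (by omega)
  · intro X hX h1 h2
    obtain ⟨Y', hY', hD'⟩ := hD.exists_step X (by omega) (by omega)
    refine ⟨Y', hcard Y' (nonempty_of_isStep hY' (Finset.card_pos.1 (by omega))) ?_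
      (by omega) (by omega), hY', hD'⟩
    exact hX ▸ card_le_of_isStep hY'
  · refine ⟨g, by rwa [decode_thirty], ?_, ?_, ?_⟩
    · rw [hdec, Finset.image_insert, Finset.image_singleton, hpq, Finset.pair_eq_singleton,
        Finset.card_singleton]
    · rw [decode_thirty, hgY]
      exact hcard Y hYne (Nat.lt_succ_iff.1 hY4) (by omega) hYB
    · rw [decode_thirty, hgY]

end IsSyncRank

end Quadruples

section Tables

/-- The partial map of `Fin n` given by its table of values, with `0` for an undefined value and
`j + 1` for the value `j`. -/
def tableMap (n m : ℕ) (table : List (List ℕ)) (q : Fin n) (a : Fin m) : Option (Fin n) :=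
  if h : 0 < (table.getD a []).getD q 0 ∧ (table.getD a []).getD q 0 ≤ n then
    some ⟨(table.getD a []).getD q 0 - 1, by omega⟩
  else none

/-- The value in a table at the set `X`. -/
def tableRank {n : ℕ} (table : List ℕ) (X : Finset (Fin n)) : ℕ :=
  table.getD (∑ i ∈ X, 2 ^ (i : ℕ)) 0

theorem le_length_of_rank {n m : ℕ} {δ : Fin n → Fin m → Option (Fin n)}
    {φ : Finset (Fin n) → ℕ} (h₁ : ∀ X, X.card = 1 → φ X = 0)
    (h : ∀ X a, pfaStep δ X a = ∅ ∨ φ X ≤ φ (pfaStep δ X a) + 1) {X : Finset (Fin n)}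
    {w : List (Fin m)} (hw : pfaSync δ X w) : φ X ≤ w.length := by
  induction w generalizing X with
  | nil => exact (h₁ X hw).le
  | cons a w ih =>
    rw [pfaSync, pfaRun_cons] at hw
    rcases h X a with hX | hX
    · rw [hX, pfaRun_empty] at hw
      simp at hw
    · exact hX.trans (Nat.succ_le_succ (ih hw))

theorem exists_shortest_of_tables (n k l : ℕ) (maps : List (List ℕ)) (ranks : List ℕ)
    (S : Finset (Fin n)) (hS : S.card = k)
    (h₁ : ∀ X : Finset (Fin n), X.card = 1 → tableRank ranks X = 0)
    (h : ∀ X a, pfaStep (tableMap n l maps) X a = ∅ ∨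
      tableRank ranks X ≤ tableRank ranks (pfaStep (tableMap n l maps) X a) + 1)
    (hw : (pfaRun (tableMap n l maps) S (List.finRange l)).card = 1) (hl : tableRank ranks S = l) :
    ∃ (m : ℕ) (δ : Fin n → Fin m → Option (Fin n)) (S : Finset (Fin n)),
      S.card = k ∧ pfaShortestSync δ S l :=
  ⟨l, tableMap n l maps, S, hS, ⟨_, hw, List.length_finRange⟩, fun _ hw' =>
    hl.ge.trans (le_length_of_rank h₁ h hw')⟩

theorem exists_shortest_three_two : ∃ (m : ℕ) (δ : Fin 3 → Fin m → Option (Fin 3))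
    (S : Finset (Fin 3)), S.card = 2 ∧ pfaShortestSync δ S 3 :=
  exists_shortest_of_tables 3 2 3
    [[1, 3, 0], [2, 0, 3], [0, 3, 3]]
    [0, 0, 0, 3, 0, 2, 1, 1]
    {0, 1} (by decide) (by decide +kernel) (by decide +kernel) (by decide +kernel)
    (by decide +kernel)

theorem exists_shortest_three_three : ∃ (m : ℕ) (δ : Fin 3 → Fin m → Option (Fin 3))
    (S : Finset (Fin 3)), S.card = 3 ∧ pfaShortestSync δ S 4 :=
  exists_shortest_of_tables 3 3 4
    [[1, 2, 1], [2, 3, 0], [0, 1, 3], [3, 0, 3]]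
    [0, 0, 0, 3, 0, 1, 2, 4]
    Finset.univ (by decide) (by decide +kernel) (by decide +kernel) (by decide +kernel)
    (by decide +kernel)

theorem exists_shortest_four_two : ∃ (m : ℕ) (δ : Fin 4 → Fin m → Option (Fin 4))
    (S : Finset (Fin 4)), S.card = 2 ∧ pfaShortestSync δ S 6 :=
  exists_shortest_of_tables 4 2 6
    [[0, 0, 1, 3], [1, 0, 2, 0], [2, 4, 0, 0], [0, 1, 0, 4], [2, 0, 0, 3], [0, 1, 1, 0]]
    [0, 0, 0, 4, 0, 5, 1, 1, 0, 2, 3, 1, 6, 1, 1, 1]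
    {2, 3} (by decide) (by decide +kernel) (by decide +kernel) (by decide +kernel)
    (by decide +kernel)

theorem exists_shortest_four_three : ∃ (m : ℕ) (δ : Fin 4 → Fin m → Option (Fin 4))
    (S : Finset (Fin 4)), S.card = 3 ∧ pfaShortestSync δ S 10 :=
  exists_shortest_of_tables 4 3 10
    [[2, 1, 0, 3], [3, 1, 4, 0], [3, 0, 4, 2], [0, 1, 4, 1], [2, 0, 0, 3], [0, 1, 2, 0], [1, 3,
      0, 0], [3, 0, 4, 0], [0, 0, 2, 4], [0, 2, 0, 2]]
    [0, 0, 0, 4, 0, 3, 5, 9, 0, 6, 1, 10, 2, 8, 7, 0]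
    {0, 1, 3} (by decide) (by decide +kernel) (by decide +kernel) (by decide +kernel)
    (by decide +kernel)

theorem exists_shortest_four_four : ∃ (m : ℕ) (δ : Fin 4 → Fin m → Option (Fin 4))
    (S : Finset (Fin 4)), S.card = 4 ∧ pfaShortestSync δ S 10 :=
  exists_shortest_of_tables 4 4 10
    [[1, 3, 3, 4], [1, 0, 2, 4], [2, 4, 0, 3], [0, 3, 3, 4], [0, 0, 2, 4], [0, 1, 0, 2], [1, 3,
      0, 0], [1, 0, 4, 0], [2, 0, 0, 3], [0, 2, 2, 0]]
    [0, 0, 0, 4, 0, 3, 1, 2, 0, 2, 5, 8, 6, 9, 7, 10]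
    Finset.univ (by decide) (by decide +kernel) (by decide +kernel) (by decide +kernel)
    (by decide +kernel)

theorem exists_shortest_five_two : ∃ (m : ℕ) (δ : Fin 5 → Fin m → Option (Fin 5))
    (S : Finset (Fin 5)), S.card = 2 ∧ pfaShortestSync δ S 10 :=
  exists_shortest_of_tables 5 2 10
    [[0, 0, 0, 3, 5], [0, 0, 1, 0, 5], [3, 0, 0, 0, 4], [0, 0, 1, 4, 0], [1, 0, 0, 3, 0], [2, 0,
      5, 0, 0], [0, 2, 0, 0, 4], [0, 1, 0, 2, 0], [2, 3, 0, 0, 0], [0, 1, 1, 0, 0]]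
    [0, 0, 0, 2, 0, 5, 1, 1, 0, 6, 3, 1, 7, 1, 1, 1, 0, 8, 4, 1, 9, 1, 1, 1, 10, 1, 1, 1, 1, 1,
      1, 1]
    {3, 4} (by decide) (by decide +kernel) (by decide +kernel) (by decide +kernel)
    (by decide +kernel)

theorem exists_shortest_five_three : ∃ (m : ℕ) (δ : Fin 5 → Fin m → Option (Fin 5))
    (S : Finset (Fin 5)), S.card = 3 ∧ pfaShortestSync δ S 20 :=
  exists_shortest_of_tables 5 3 20
    [[1, 0, 2, 0, 4], [3, 4, 0, 2, 0], [0, 5, 4, 3, 0], [0, 0, 1, 4, 5], [1, 0, 0, 2, 3], [3, 4,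
      1, 0, 0], [1, 0, 5, 2, 0], [3, 2, 0, 0, 5], [0, 5, 4, 0, 2], [0, 4, 0, 4, 5], [0, 0, 0, 2,
      3], [0, 1, 4, 0, 0], [1, 0, 0, 2, 0], [3, 4, 0, 0, 0], [0, 0, 2, 5, 0], [0, 1, 0, 0, 3],
      [1, 0, 5, 0, 0], [3, 0, 0, 0, 5], [0, 0, 2, 0, 4], [0, 1, 0, 1, 0]]
    [0, 0, 0, 7, 0, 4, 9, 15, 0, 8, 1, 19, 6, 14, 18, 0, 0, 3, 5, 13, 2, 20, 12, 0, 10, 16, 11,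
      0, 17, 0, 0, 0]
    {0, 2, 4} (by decide) (by decide +kernel) (by decide +kernel) (by decide +kernel)
    (by decide +kernel)

theorem exists_shortest_five_five : ∃ (m : ℕ) (δ : Fin 5 → Fin m → Option (Fin 5))
    (S : Finset (Fin 5)), S.card = 5 ∧ pfaShortestSync δ S 21 :=
  exists_shortest_of_tables 5 5 21
    [[1, 2, 3, 1, 5], [4, 2, 3, 0, 5], [0, 2, 1, 3, 4], [1, 2, 3, 1, 0], [4, 2, 3, 0, 0], [0, 2,
      5, 4, 0], [0, 2, 0, 1, 5], [1, 3, 0, 0, 5], [4, 0, 3, 0, 5], [0, 0, 1, 3, 4], [1, 0, 3, 1,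
      0], [3, 0, 4, 0, 0], [0, 0, 4, 5, 0], [0, 0, 0, 1, 5], [1, 0, 0, 0, 2], [2, 4, 0, 0, 0],
      [0, 2, 0, 3, 0], [0, 2, 5, 0, 0], [0, 3, 0, 0, 5], [0, 0, 1, 0, 4], [1, 0, 0, 1, 0]]
    [0, 0, 0, 6, 0, 10, 4, 17, 0, 1, 5, 7, 9, 11, 16, 18, 0, 7, 3, 14, 2, 13, 5, 20, 8, 8, 15,
      15, 12, 14, 19, 21]
    Finset.univ (by decide) (by decide +kernel) (by decide +kernel) (by decide +kernel)
    (by decide +kernel)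

theorem exists_shortest_five_four : ∃ (m : ℕ) (δ : Fin 5 → Fin m → Option (Fin 5))
    (S : Finset (Fin 5)), S.card = 4 ∧ pfaShortestSync δ S 22 :=
  exists_shortest_of_tables 5 4 22
    [[0, 2, 3, 4, 1], [4, 1, 3, 5, 0], [1, 0, 3, 2, 5], [2, 1, 3, 0, 2], [4, 1, 3, 0, 0], [4, 0,
      3, 5, 0], [0, 0, 3, 2, 5], [0, 5, 2, 0, 4], [0, 2, 0, 4, 1], [4, 1, 0, 5, 0], [1, 0, 0, 2,
      5], [1, 2, 0, 0, 1], [1, 4, 0, 0, 0], [4, 0, 0, 5, 0], [0, 0, 0, 2, 5], [0, 2, 0, 0, 3],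
      [0, 1, 3, 0, 0], [3, 0, 4, 0, 0], [0, 0, 3, 5, 0], [0, 0, 2, 0, 4], [0, 1, 0, 5, 0], [4,
      0, 0, 0, 4]]
    [0, 0, 0, 10, 0, 5, 6, 18, 0, 9, 2, 13, 4, 17, 8, 21, 0, 1, 7, 11, 3, 7, 15, 19, 8, 12, 14,
      20, 16, 20, 22, 0]
    {1, 2, 3, 4} (by decide) (by decide +kernel) (by decide +kernel) (by decide +kernel)
    (by decide +kernel)

end Tables

section Maximum

theorem le_T1_of_isSyncRank {n k B : ℕ} (hn3 : 3 ≤ n) (hn : n ≤ 5) (hk : 2 ≤ k) (hkn : k ≤ n)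
    {D : Finset (Fin n) → ℕ} (hD : IsSyncRank B D) {S : Finset (Fin n)} (hS : S.card = k)
    (hlt : D S < B) : D S ≤ T1 n k := by
  have hSne : S.Nonempty := Finset.card_pos.1 (by omega)
  have h := hD.le_card_midSubsets hSne hlt hS.le
  obtain ⟨h32, h33, h42, h43, h52, h53⟩ := card_midSubsets
  have huniv : ∀ {m : ℕ} {S : Finset (Fin m)}, S.card = m → S = Finset.univ := fun {m S} hS =>
    (Finset.card_eq_iff_eq_univ S).1 (by simpa using hS)
  interval_cases n <;> interval_cases k
  · rwa [h32] at h
  · rwa [h33] at h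
  · rwa [h42] at h
  · rwa [h43] at h
  · obtain rfl := huniv hS
    exact hD.le_ten_of_four hlt
  · rwa [h52] at h
  · rwa [h53] at h
  · exact hD.le_of_quadruple hS hlt
  · obtain rfl := huniv hS
    exact hD.le_of_univ hlt

theorem lt_T1_of_isSyncRank {n k B : ℕ} (hn3 : 3 ≤ n) (hn : n ≤ 5) (hk : 2 ≤ k) (hkn : k ≤ n)
    {D : Finset (Fin n) → ℕ} (hD : IsSyncRank B D) {S S' : Finset (Fin n)} (hS : S.card = k)
    (hlt : D S < B) (hS'ne : S'.Nonempty) (hS' : S'.card < k) (hB : D S' = B) :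
    D S < T1 n k := by
  have hSne : S.Nonempty := Finset.card_pos.1 (by omega)
  have h := hD.lt_card_midSubsets hSne hlt hS.le hS'ne hS'.le hB
  have hfull : k ≠ n := by
    rintro rfl
    have := hD.mono hS'ne (Finset.subset_univ S')
    rw [(Finset.card_eq_iff_eq_univ S).1 (by simpa using hS)] at hlt
    omega
  obtain ⟨h32, h33, h42, h43, h52, h53⟩ := card_midSubsets
  interval_cases n <;> interval_cases k <;> try exact absurd rfl hfull
  · rwa [h32] at h
  · rwa [h42] at h
  · rwa [h43] at h
  · rwa [h52] at h
  · rwa [h53] at h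
  · obtain ⟨T, hT, hTB⟩ := hD.exists_superset_eq_bound (k := 3) hS'ne (by omega) (by norm_num) hB
    exact Nat.lt_succ_of_le (hD.le_of_quadruple_of_bound hS hlt hT hTB)

end Maximum

theorem stmt1 (n k : ℕ) (hn3 : 3 ≤ n) (hn : n ≤ 5) (hk : 2 ≤ k) (hkn : k ≤ n) :
    IsGreatest {l : ℕ | ∃ (m : ℕ) (δ : Fin n → Fin m → Option (Fin n)) (S : Finset (Fin n)),
      S.card = k ∧ pfaShortestSync δ S l} (T1 n k) ∧
    (∀ (m : ℕ) (δ : Fin n → Fin m → Option (Fin n)) (S : Finset (Fin n)) (l : ℕ),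
      S.card = k →
      (∃ S' : Finset (Fin n), S'.Nonempty ∧ S'.card < k ∧ ¬ (∃ w, pfaSync δ S' w)) →
      pfaShortestSync δ S l → l < T1 n k) := by
  refine ⟨⟨?_, ?_⟩, ?_⟩
  · interval_cases n <;> interval_cases k
    exacts [exists_shortest_three_two, exists_shortest_three_three, exists_shortest_four_two,
      exists_shortest_four_three, exists_shortest_four_four, exists_shortest_five_two,
      exists_shortest_five_three, exists_shortest_five_four, exists_shortest_five_five]
  · rintro l ⟨m, δ, S, hS, hl⟩
    have hD := syncRank_eq_of_shortest hl (Nat.lt_succ_self l)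
    have := le_T1_of_isSyncRank hn3 hn hk hkn (isSyncRank_syncRank l.succ_pos δ) hS
      (by rw [hD]; exact Nat.lt_succ_self l)
    rwa [hD] at this
  · rintro m δ S l hS ⟨S', hne, hcard, hS'⟩ hl
    have hD := syncRank_eq_of_shortest hl (Nat.lt_succ_self l)
    have := lt_T1_of_isSyncRank hn3 hn hk hkn (isSyncRank_syncRank l.succ_pos δ) hS
      (by rw [hD]; exact Nat.lt_succ_self l) hne hcard (syncRank_eq_bound hS')
    rwa [hD] at this
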